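/- Let K be a number field with class number h_K and fix an ideal class 𝒞 ∈ Cl(K). Then lim_{X→∞} #{L/K : [L:K] = 2, N(Δ_{L/K}) ≤ X, St(𝒪_L) = 𝒞} / #{L/K : [L:K] = 2, N(Δ_{L/K}) ≤ X} = 1/h_K. That is, Steinitz classes of quadratic extensions of K are equidistributed among all ideal classes of K. -/

import Mathlib

open NumberField Filter
open scoped nonZeroDivisors

noncomputable section

/-- The relative discriminant ideal of `L/K`. -/
def relDisc (K L : Type*) [Field K] [NumberField K] [Field L] [Algebra K L] :
    Ideal (𝓞 K) :=
  Ideal.span {d : 𝓞 K | ∃ b : Module.Basis (Fin (Module.finrank K L)) K L,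
    (∀ i, IsIntegral ℤ (b i)) ∧ algebraMap (𝓞 K) K d = Algebra.discr K ⇑b}

/-- `c` is the Steinitz class of `L/K`. -/
def IsSteinitzClass (K : Type*) [Field K] [NumberField K] (L : Type*) [Field L]
    [Algebra K L] (c : ClassGroup (𝓞 K)) : Prop :=
  ∃ I : (Ideal (𝓞 K))⁰, ClassGroup.mk0 I = c ∧
    Nonempty ((𝓞 L) ≃ₗ[𝓞 K] ((Fin (Module.finrank K L - 1) → 𝓞 K) × (I : Ideal (𝓞 K))))

namespace SteinitzQuadratic

set_option linter.unusedSectionVars false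

section SquareModule

variable {K : Type*} [Field K] [NumberField K]

/-- The group of nonzero fractional ideals of `K`. -/
abbrev FracUnits (K : Type*) [Field K] [NumberField K] := (FractionalIdeal (𝓞 K)⁰ K)ˣ

lemma exists_integer_of_quadratic (b c : 𝓞 K) (f : K) (h : f ^ 2 + algebraMap _ K b * f = algebraMap _ K c) :
    ∃ y : 𝓞 K, algebraMap _ K y = f := by
  have : IsIntegral (𝓞 K) f := by
    refine ⟨Polynomial.X ^ 2 + (Polynomial.C b * Polynomial.X - Polynomial.C c), ?_, ?_⟩
    · apply Polynomial.monic_X_pow_add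
      compute_degree
      norm_num
    · simp only [Polynomial.eval₂_add, Polynomial.eval₂_sub, Polynomial.eval₂_mul,
        Polynomial.eval₂_pow, Polynomial.eval₂_X, Polynomial.eval₂_C]
      linear_combination h
  exact IsIntegrallyClosed.isIntegral_iff.mp this

lemma exists_integer_of_sq (c : 𝓞 K) (f : K) (h : f ^ 2 = algebraMap _ K c) : ∃ y : 𝓞 K, algebraMap _ K y = f :=
  exists_integer_of_quadratic 0 c f (by simp [h])

/-- `a` is an integer of `K` congruent to a square modulo `4`. -/
def IsSqModFour (a : K) : Prop := ∃ t r : 𝓞 K, a = algebraMap _ K t ^ 2 + 4 * algebraMap _ K r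

lemma IsSqModFour.add_four_mul {a : K} (h : IsSqModFour a) (s : 𝓞 K) :
    IsSqModFour (a + 4 * algebraMap _ K s) := by
  obtain ⟨t, r, rfl⟩ := h
  exact ⟨t, r + s, by simp only [map_add, map_mul, map_pow, map_neg, map_ofNat, map_zero]; ring⟩

lemma isSqModFour_congr {a b : K} (s : 𝓞 K) (h : b = a + 4 * algebraMap _ K s) :
    IsSqModFour a ↔ IsSqModFour b := by
  constructor
  · rintro ha; rw [h]; exact ha.add_four_mul s
  · intro hb
    have := hb.add_four_mul (-s)
    rw [h] at this
    convert this using 1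
    simp only [map_add, map_mul, map_pow, map_neg, map_ofNat, map_zero]; ring

lemma IsSqModFour.exists_integer {a : K} (h : IsSqModFour a) : ∃ y : 𝓞 K, algebraMap _ K y = a := by
  obtain ⟨t, r, rfl⟩ := h
  exact ⟨t ^ 2 + 4 * r, by simp only [map_add, map_mul, map_pow, map_ofNat]⟩

lemma exists_integer_mul_mul {α v w : K} (hv : IsSqModFour (α * v ^ 2))
    (hw : IsSqModFour (α * w ^ 2)) : ∃ y : 𝓞 K, algebraMap _ K y = α * v * w := by
  obtain ⟨a, ha⟩ := hv.exists_integer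
  obtain ⟨b, hb⟩ := hw.exists_integer
  exact exists_integer_of_sq (a * b) _ (by simp only [map_add, map_mul, map_pow, map_neg, map_ofNat, map_zero]; rw [ha, hb]; ring)

lemma IsSqModFour.add {α v w : K} (hv : IsSqModFour (α * v ^ 2))
    (hw : IsSqModFour (α * w ^ 2)) : IsSqModFour (α * (v + w) ^ 2) := by
  obtain ⟨e, he⟩ := exists_integer_mul_mul hv hw
  obtain ⟨t₁, r₁, h₁⟩ := hv
  obtain ⟨t₂, r₂, h₂⟩ := hw
  have key : (algebraMap _ K e) ^ 2 = (algebraMap _ K t₁ ^ 2 + 4 * algebraMap _ K r₁) * (algebraMap _ K t₂ ^ 2 + 4 * algebraMap _ K r₂) := by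
    rw [he, ← h₁, ← h₂]; ring
  obtain ⟨f, hf⟩ := exists_integer_of_quadratic (t₁ * t₂)
    (t₁ ^ 2 * r₂ + r₁ * t₂ ^ 2 + 4 * r₁ * r₂) ((algebraMap _ K e - algebraMap _ K (t₁ * t₂)) / 2) (by
      simp only [map_add, map_mul, map_pow, map_neg, map_ofNat, map_zero]
      linear_combination (1 / 4 : K) * key)
  refine ⟨t₁ + t₂, r₁ + r₂ + f, ?_⟩
  simp only [map_add, map_mul, map_pow, map_neg, map_ofNat, map_zero]
  rw [hf, map_mul]
  linear_combination h₁ + h₂ - 2 * he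

/-- The module of those `w` for which `α * w ^ 2` is an integer congruent to a square modulo `4`.
If `θ ^ 2 = α`, these are the `w` such that `(t + w * θ) / 2` is integral for some `t`. -/
def sqModule (α : K) : Submodule (𝓞 K) K where
  carrier := {w | IsSqModFour (α * w ^ 2)}
  add_mem' := fun hv hw => hv.add hw
  zero_mem' := ⟨0, 0, by simp⟩
  smul_mem' := by
    rintro c w ⟨t, r, h⟩
    refine ⟨c * t, c ^ 2 * r, ?_⟩
    rw [Algebra.smul_def]
    simp only [map_add, map_mul, map_pow, map_neg, map_ofNat, map_zero]
    linear_combination algebraMap _ K c ^ 2 * h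

lemma sqModule_isFractional {α : K} (hα : α ≠ 0) :
    IsFractional (𝓞 K)⁰ (sqModule α) := by
  obtain ⟨d, hd, hdα⟩ := IsFractionRing.div_surjective (A := 𝓞 K) α
  obtain ⟨hd0, rfl⟩ := hdα
  have hd1 : algebraMap _ K d ≠ 0 := by rintro h; simp [h] at hα
  have hd2 : algebraMap _ K hd ≠ 0 := by rintro h; simp [h] at hα
  refine ⟨d, mem_nonZeroDivisors_of_ne_zero (by simpa using hd1), fun w hw => ?_⟩
  obtain ⟨a, ha⟩ := IsSqModFour.exists_integer hw
  obtain ⟨y, hy⟩ := exists_integer_of_sq (a * d * hd) (algebraMap _ K d * w) (by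
    simp only [map_add, map_mul, map_pow, map_neg, map_ofNat, map_zero]; rw [ha]; field_simp)
  exact ⟨y, by rw [Algebra.smul_def]; exact hy⟩

lemma exists_ne_zero_mem_sqModule (α : K) : ∃ w ∈ sqModule α, w ≠ 0 := by
  obtain ⟨n, d, hd0, rfl⟩ := IsFractionRing.div_surjective (A := 𝓞 K) α
  have hd2 : algebraMap _ K d ≠ 0 := by simpa using nonZeroDivisors.ne_zero hd0
  refine ⟨2 * d, ⟨0, n * d, ?_⟩, by simpa using hd2⟩
  simp only [map_add, map_mul, map_pow, map_neg, map_ofNat, map_zero]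
  field_simp
  ring

/-- `sqModule α` as an invertible fractional ideal. -/
def sqIdeal (α : Kˣ) : FracUnits K :=
  Units.mk0 ⟨sqModule (α : K), sqModule_isFractional α.ne_zero⟩ (by
    obtain ⟨w, hw, hw0⟩ := exists_ne_zero_mem_sqModule (α : K)
    intro h
    have h' : sqModule (α : K) = ((0 : FractionalIdeal (𝓞 K)⁰ K) : Submodule (𝓞 K) K) :=
      congrArg Subtype.val h
    rw [h'] at hw
    exact hw0 (by simpa using hw))

lemma mem_sqIdeal {α : Kˣ} {w : K} :
    w ∈ (sqIdeal α : FractionalIdeal (𝓞 K)⁰ K) ↔ IsSqModFour ((α : K) * w ^ 2) := Iff.rfl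

/-- The principal fractional ideal of a unit. -/
abbrev prin (x : Kˣ) : FracUnits K := toPrincipalIdeal (𝓞 K) K x

lemma mem_prin_mul {x : Kˣ} {I : FracUnits K} {w : K} :
    w ∈ ((prin x * I : FracUnits K) : FractionalIdeal (𝓞 K)⁰ K) ↔
      (x⁻¹ : K) * w ∈ (I : FractionalIdeal (𝓞 K)⁰ K) := by
  rw [Units.val_mul, coe_toPrincipalIdeal, FractionalIdeal.mem_singleton_mul]
  constructor
  · rintro ⟨y, hy, rfl⟩
    simpa using hy
  · intro h
    exact ⟨_, h, by simp⟩

lemma sqIdeal_mul_sq (α s : Kˣ) : sqIdeal (α * s ^ 2) = prin s⁻¹ * sqIdeal α := by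
  ext w
  rw [mem_prin_mul, mem_sqIdeal, mem_sqIdeal]
  rw [iff_iff_eq]
  congr 1
  push_cast
  simp only [inv_inv]
  ring

lemma mem_one_fracUnits {w : K} :
    w ∈ ((1 : FracUnits K) : FractionalIdeal (𝓞 K)⁰ K) ↔ ∃ y : 𝓞 K, algebraMap _ K y = w := by
  rw [Units.val_one, FractionalIdeal.mem_one_iff]

lemma mul_mul_mem_one {I J M : FracUnits K} {x y : K}
    (hx : x ∈ (I : FractionalIdeal (𝓞 K)⁰ K)) (hy : y ∈ (J : FractionalIdeal (𝓞 K)⁰ K))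
    (h : I * J ≤ M) : x * y ∈ (M : FractionalIdeal (𝓞 K)⁰ K) := by
  have h' : ((I : FractionalIdeal (𝓞 K)⁰ K)) * J ≤ M := by exact_mod_cast h
  exact h' (FractionalIdeal.mul_mem_mul hx hy)

lemma prin_mul_sqIdeal_sq_le_one (α : Kˣ) : prin α * sqIdeal α ^ 2 ≤ 1 := by
  rw [← Units.val_le_val, sq, Units.val_mul, Units.val_mul, coe_toPrincipalIdeal,
    FractionalIdeal.spanSingleton_mul_le_iff]
  intro z hz
  refine FractionalIdeal.mul_induction_on hz (fun i hi j hj => ?_) (fun x y hx hy => ?_)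
  · rw [mem_one_fracUnits]
    obtain ⟨y, hy⟩ := exists_integer_mul_mul (mem_sqIdeal.1 hi) (mem_sqIdeal.1 hj)
    exact ⟨y, by rw [hy]; ring⟩
  · rw [mul_add]
    exact Submodule.add_mem _ hx hy

end SquareModule

section Splitting

variable {K : Type*} [Field K] [NumberField K]

/-- `t` is an integer whose square is congruent to `α * w ^ 2` modulo `4`. -/
def IsSqRep (α w t : K) : Prop :=
  (∃ t' : 𝓞 K, algebraMap _ K t' = t) ∧ ∃ r : 𝓞 K, t ^ 2 - α * w ^ 2 = 4 * algebraMap _ K r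

lemma IsSqRep.mem {α w t : K} (h : IsSqRep α w t) : IsSqModFour (α * w ^ 2) := by
  obtain ⟨⟨t', rfl⟩, r, hr⟩ := h
  exact ⟨t', -r, by rw [map_neg]; linear_combination -hr⟩

lemma IsSqModFour.exists_isSqRep {α w : K} (h : IsSqModFour (α * w ^ 2)) :
    ∃ t, IsSqRep α w t := by
  obtain ⟨t, r, h⟩ := h
  exact ⟨algebraMap _ K t, ⟨t, rfl⟩, -r, by rw [map_neg]; linear_combination -h⟩

lemma IsSqRep.add {α v w s t : K} (hv : IsSqRep α v s) (hw : IsSqRep α w t) :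
    IsSqRep α (v + w) (s + t) := by
  obtain ⟨e, he⟩ := exists_integer_mul_mul hv.mem hw.mem
  obtain ⟨⟨s, rfl⟩, r₁, h₁⟩ := hv
  obtain ⟨⟨t, rfl⟩, r₂, h₂⟩ := hw
  obtain ⟨f, hf⟩ := exists_integer_of_quadratic (s * t)
    (4 * r₁ * r₂ - s ^ 2 * r₂ - r₁ * t ^ 2)
    ((algebraMap _ K e - algebraMap _ K (s * t)) / 2) (by
      simp only [map_sub, map_mul, map_pow, map_ofNat]
      rw [he]
      linear_combination (-(1 / 4 : K) * α * w ^ 2) * h₁ +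
        (-1 / 4 * algebraMap _ K s ^ 2 + algebraMap _ K r₁) * h₂)
  refine ⟨⟨s + t, map_add _ _ _⟩, r₁ + r₂ - f, ?_⟩
  simp only [map_add, map_sub, map_mul] at hf ⊢
  rw [hf, he]
  linear_combination h₁ + h₂

lemma IsSqRep.smul {α w t : K} (h : IsSqRep α w t) (c : 𝓞 K) :
    IsSqRep α (algebraMap _ K c * w) (algebraMap _ K c * t) := by
  obtain ⟨⟨t, rfl⟩, r, h⟩ := h
  refine ⟨⟨c * t, map_mul _ _ _⟩, c ^ 2 * r, ?_⟩
  simp only [map_mul, map_pow]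
  linear_combination (algebraMap _ K c) ^ 2 * h

lemma exists_slope (α : Kˣ) :
    ∃ σ : K, ∀ w ∈ (sqIdeal α : FractionalIdeal (𝓞 K)⁰ K), IsSqRep (α : K) w (w * σ) := by
  have key : ∀ x ∈ ((sqIdeal α * (sqIdeal α)⁻¹ : FracUnits K) : FractionalIdeal (𝓞 K)⁰ K),
      ∃ σ : K, ∀ w ∈ (sqIdeal α : FractionalIdeal (𝓞 K)⁰ K),
        IsSqRep (α : K) (w * x) (w * σ) := by
    intro x hx
    rw [Units.val_mul] at hx
    refine FractionalIdeal.mul_induction_on hx (fun d hd e he => ?_) (fun x y hx hy => ?_)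
    · obtain ⟨t, ht⟩ := (mem_sqIdeal.1 hd).exists_isSqRep
      refine ⟨e * t, fun w hw => ?_⟩
      obtain ⟨c, hc⟩ := mem_one_fracUnits.1
        (mul_mul_mem_one hw he (le_of_eq (mul_inv_cancel _)))
      have := ht.smul c
      rw [hc] at this
      convert this using 1 <;> ring
    · obtain ⟨σ, hσ⟩ := hx
      obtain ⟨τ, hτ⟩ := hy
      refine ⟨σ + τ, fun w hw => ?_⟩
      rw [mul_add, mul_add]
      exact (hσ w hw).add (hτ w hw)
  obtain ⟨σ, hσ⟩ := key 1 (by rw [mul_inv_cancel, mem_one_fracUnits]; exact ⟨1, map_one _⟩)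
  exact ⟨σ, fun w hw => by simpa using hσ w hw⟩

end Splitting

section SteinitzUnique

variable {R : Type*} [CommRing R] [IsDedekindDomain R]

lemma mk0_eq_of_prod_equiv (I J : (Ideal R)⁰)
    (φ : (R × (I : Ideal R)) ≃ₗ[R] (R × (J : Ideal R))) : ClassGroup.mk0 I = ClassGroup.mk0 J := by
  have hI : (I : Ideal R) ≠ ⊥ := nonZeroDivisors.coe_ne_zero I
  have hJ : (J : Ideal R) ≠ ⊥ := nonZeroDivisors.coe_ne_zero J
  obtain ⟨x₀, hx₀, hx₀0⟩ := Submodule.exists_mem_ne_zero_of_ne_bot hI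
  obtain ⟨y₀, hy₀, hy₀0⟩ := Submodule.exists_mem_ne_zero_of_ne_bot hJ
  set a : R := (φ (1, 0)).1 with ha
  set c : R := ((φ (1, 0)).2 : R) with hc
  let b : ↥(I : Ideal R) → R := fun x => (φ (0, x)).1
  let d : ↥(I : Ideal R) → R := fun x => ((φ (0, x)).2 : R)
  let x₀' : (I : Ideal R) := ⟨x₀, hx₀⟩
  have hcomm : ∀ x : (I : Ideal R), (x₀ : R) • φ (0, x) = (x : R) • φ (0, x₀') := by
    intro x
    rw [← map_smul, ← map_smul]
    congr 1
    ext
    · simp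
    · simp [x₀', mul_comm]
  have hb : ∀ x : (I : Ideal R), x₀ * b x = x * b x₀' := fun x => by
    have := congrArg Prod.fst (hcomm x)
    simpa using this
  have hd : ∀ x : (I : Ideal R), x₀ * d x = x * d x₀' := fun x => by
    have := congrArg (fun z => (z.2 : R)) (hcomm x)
    simpa using this
  have hdec : ∀ (p : R) (x : (I : Ideal R)),
      (φ (p, x)).1 = p * a + b x ∧ ((φ (p, x)).2 : R) = p * c + d x := by
    intro p x
    have : (p, x) = p • ((1 : R), (0 : (I : Ideal R))) + (0, x) := by ext <;> simp
    rw [this, map_add, map_smul]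
    simp [a, c, b, d]
  let ψ : ↥(I : Ideal R) → R := fun x => a * d x - b x * c
  have hψ : ∀ x : (I : Ideal R), x₀ * ψ x = x * ψ x₀' := fun x => by
    linear_combination a * hd x - c * hb x
  have hψJ : ∀ x, ψ x ∈ (J : Ideal R) := fun x =>
    sub_mem (Ideal.mul_mem_left _ _ (φ (0, x)).2.2) (Ideal.mul_mem_left _ _ (φ (1, 0)).2.2)
  have hsurj : ∀ y ∈ (J : Ideal R), ∃ v : (I : Ideal R), x₀ * y = v * ψ x₀' := by
    intro y hy
    obtain ⟨⟨p, x⟩, hpx⟩ := φ.surjective (0, ⟨y, hy⟩)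
    obtain ⟨⟨q, x'⟩, hqx⟩ := φ.surjective (1, 0)
    obtain ⟨h1, h2⟩ := hdec p x
    obtain ⟨h3, h4⟩ := hdec q x'
    rw [hpx] at h1 h2
    rw [hqx] at h3 h4
    simp only [ZeroMemClass.coe_zero] at h1 h2 h3 h4
    refine ⟨q • x - p • x', ?_⟩
    have h5 : x₀ * x₀ * (b x' * d x - d x' * b x) = 0 := by
      linear_combination (x₀ * d x) * hb x' + (x' * b x₀') * hd x - (x₀ * b x) * hd x' -
        (x' * d x₀') * hb x
    have h6 : b x' * d x - d x' * b x = 0 := by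
      rcases mul_eq_zero.1 h5 with h | h
      · exact absurd (mul_self_eq_zero.1 h) hx₀0
      · exact h
    have h7 : y = q * ψ x - p * ψ x' := by
      simp only [ψ]
      linear_combination h2 + (p * c + d x) * h3 - (p * a + b x) * h4 + h6
    rw [h7]
    push_cast
    simp only [smul_eq_mul]
    linear_combination q * hψ x - p * hψ x'
  have hψ0 : ψ x₀' ≠ 0 := by
    intro h
    obtain ⟨v, hv⟩ := hsurj y₀ hy₀
    rw [h, mul_zero] at hv
    exact (mul_ne_zero hx₀0 hy₀0) hv
  rw [ClassGroup.mk0_eq_mk0_iff]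
  refine ⟨ψ x₀', x₀, hψ0, hx₀0, le_antisymm ?_ ?_⟩
  · rw [Ideal.span_singleton_mul_le_span_singleton_mul]
    intro x hx
    exact ⟨ψ ⟨x, hx⟩, hψJ _, by rw [hψ ⟨x, hx⟩, mul_comm]⟩
  · rw [Ideal.span_singleton_mul_le_span_singleton_mul]
    intro y hy
    obtain ⟨v, hv⟩ := hsurj y hy
    exact ⟨v, v.2, by rw [hv, mul_comm]⟩

end SteinitzUnique

section QuadraticExtension

variable {K : Type*} [Field K] [NumberField K] {L : Type*} [Field L] [Algebra K L]
  {α : Kˣ} {θ : L}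

lemma linearIndependent_one_sqrt (hθ : θ ^ 2 = algebraMap K L α) (hα : ¬ IsSquare (α : K)) :
    LinearIndependent K ![(1 : L), θ] := by
  rw [LinearIndependent.pair_iff]
  intro s t h
  rw [Algebra.smul_def, Algebra.smul_def, mul_one] at h
  have ht : t = 0 := by
    by_contra ht
    have hθ' : θ = algebraMap K L (-s / t) := by
      have : algebraMap K L t ≠ 0 := by simpa using ht
      rw [map_div₀, map_neg, eq_div_iff this]
      linear_combination h
    rw [hθ', ← map_pow] at hθ
    exact hα ⟨-s / t, by rw [← sq]; exact ((algebraMap K L).injective hθ).symm⟩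
  subst ht
  simpa using h

/-- The basis `1, θ` of a quadratic extension generated by a square root `θ`. -/
def sqrtBasis (hθ : θ ^ 2 = algebraMap K L α) (hα : ¬ IsSquare (α : K))
    (h2 : Module.finrank K L = 2) : Module.Basis (Fin 2) K L :=
  basisOfLinearIndependentOfCardEqFinrank (linearIndependent_one_sqrt hθ hα) (by simp [h2])

lemma coe_sqrtBasis (hθ : θ ^ 2 = algebraMap K L α) (hα : ¬ IsSquare (α : K))
    (h2 : Module.finrank K L = 2) : ⇑(sqrtBasis hθ hα h2) = ![(1 : L), θ] := by
  simp [sqrtBasis]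

lemma exists_eq_half (hθ : θ ^ 2 = algebraMap K L α) (hα : ¬ IsSquare (α : K))
    (h2 : Module.finrank K L = 2) (z : L) :
    ∃ t w : K, z = algebraMap K L (t / 2) + algebraMap K L (w / 2) * θ := by
  refine ⟨2 * (sqrtBasis hθ hα h2).repr z 0, 2 * (sqrtBasis hθ hα h2).repr z 1, ?_⟩
  conv_lhs => rw [← (sqrtBasis hθ hα h2).sum_repr z]
  rw [Fin.sum_univ_two, coe_sqrtBasis]
  simp [Algebra.smul_def]

lemma half_injective (hθ : θ ^ 2 = algebraMap K L α) (hα : ¬ IsSquare (α : K))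
    {t w t' w' : K} (h : algebraMap K L t + algebraMap K L w * θ =
      algebraMap K L t' + algebraMap K L w' * θ) : t = t' ∧ w = w' := by
  have hli := linearIndependent_one_sqrt hθ hα
  rw [LinearIndependent.pair_iff] at hli
  have := hli (t - t') (w - w') (by
    simp only [Algebra.smul_def, map_sub]
    linear_combination h)
  exact ⟨sub_eq_zero.1 this.1, sub_eq_zero.1 this.2⟩

lemma trace_sqrt (hθ : θ ^ 2 = algebraMap K L α) (hα : ¬ IsSquare (α : K))
    (h2 : Module.finrank K L = 2) : Algebra.trace K L θ = 0 := by
  have hb := coe_sqrtBasis hθ hα h2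
  have h0 : (sqrtBasis hθ hα h2) 0 = 1 := by rw [hb]; rfl
  have h1 : (sqrtBasis hθ hα h2) 1 = θ := by rw [hb]; rfl
  rw [Algebra.trace_eq_matrix_trace (sqrtBasis hθ hα h2), Matrix.trace_fin_two,
    Algebra.leftMulMatrix_eq_repr_mul, Algebra.leftMulMatrix_eq_repr_mul]
  have e0 : θ * (sqrtBasis hθ hα h2) 0 = (sqrtBasis hθ hα h2) 1 := by rw [h0, h1, mul_one]
  have e1 : θ * (sqrtBasis hθ hα h2) 1 = (α : K) • (sqrtBasis hθ hα h2) 0 := by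
    rw [h0, h1, ← sq, hθ, Algebra.smul_def, mul_one]
  rw [e0, e1]
  simp

lemma trace_add_mul_sqrt (hθ : θ ^ 2 = algebraMap K L α) (hα : ¬ IsSquare (α : K))
    (h2 : Module.finrank K L = 2) (x y : K) :
    Algebra.trace K L (algebraMap K L x + algebraMap K L y * θ) = 2 * x := by
  rw [map_add, Algebra.trace_algebraMap, h2, ← Algebra.smul_def, map_smul,
    trace_sqrt hθ hα h2]
  simp

lemma isIntegral_int_iff_exists {x : K} : IsIntegral ℤ x ↔ ∃ y : 𝓞 K, algebraMap _ K y = x :=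
  ⟨fun h => ⟨⟨x, h⟩, rfl⟩, by rintro ⟨y, rfl⟩; exact y.2⟩

lemma isIntegral_half_iff (hθ : θ ^ 2 = algebraMap K L α) (hα : ¬ IsSquare (α : K))
    (h2 : Module.finrank K L = 2) (t w : K) :
    IsIntegral ℤ (algebraMap K L (t / 2) + algebraMap K L (w / 2) * θ) ↔
      IsSqRep (α : K) w t := by
  have : FiniteDimensional K L := Module.finite_of_finrank_pos (by omega)
  have : CharZero L := charZero_of_injective_algebraMap (algebraMap K L).injective
  set z := algebraMap K L (t / 2) + algebraMap K L (w / 2) * θ with hz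
  have htwo : algebraMap K L 2 = 2 := map_ofNat _ 2
  have hquad : z * (algebraMap K L t - z) = algebraMap K L ((t ^ 2 - α * w ^ 2) / 4) := by
    rw [hz]
    simp only [map_div₀, map_sub, map_mul, map_pow, map_ofNat]
    linear_combination (-(algebraMap K L w) ^ 2 / 4) * hθ
  constructor
  · intro h
    have ht : IsIntegral ℤ t := by
      have h3 : IsIntegral (𝓞 K) z := h.tower_top
      have := Algebra.isIntegral_trace (L := K) h3
      rw [hz, trace_add_mul_sqrt hθ hα h2] at this
      have h4 := isIntegral_trans (R := ℤ) _ this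
      convert h4 using 1
      ring
    refine ⟨isIntegral_int_iff_exists.1 ht, ?_⟩
    have h5 : IsIntegral ℤ (algebraMap K L ((t ^ 2 - α * w ^ 2) / 4)) := by
      rw [← hquad]
      exact h.mul ((ht.algebraMap).sub h)
    rw [isIntegral_algebraMap_iff (algebraMap K L).injective] at h5
    obtain ⟨r, hr⟩ := isIntegral_int_iff_exists.1 h5
    exact ⟨r, by rw [hr]; field_simp⟩
  · rintro ⟨⟨t, rfl⟩, r, hr⟩
    have : IsIntegral (𝓞 K) z := by
      refine ⟨Polynomial.X ^ 2 + (-Polynomial.C t * Polynomial.X + Polynomial.C r), ?_, ?_⟩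
      · apply Polynomial.monic_X_pow_add
        compute_degree
        norm_num
      · simp only [Polynomial.eval₂_add, Polynomial.eval₂_neg, Polynomial.eval₂_mul,
          Polynomial.eval₂_pow, Polynomial.eval₂_X, Polynomial.eval₂_C]
        rw [IsScalarTower.algebraMap_apply (𝓞 K) K L, IsScalarTower.algebraMap_apply (𝓞 K) K L]
        rw [hr, mul_div_cancel_left₀ _ (by norm_num)] at hquad
        linear_combination -hquad
    exact isIntegral_trans (R := ℤ) _ this

lemma discr_pair (hθ : θ ^ 2 = algebraMap K L α) (hα : ¬ IsSquare (α : K))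
    (h2 : Module.finrank K L = 2) (t w t' w' : K) (v : Fin 2 → L)
    (h0 : v 0 = algebraMap K L (t / 2) + algebraMap K L (w / 2) * θ)
    (h1 : v 1 = algebraMap K L (t' / 2) + algebraMap K L (w' / 2) * θ) :
    Algebra.discr K v = α * ((t * w' - t' * w) / 2) ^ 2 := by
  have hmul : ∀ a b c d : K, Algebra.trace K L
      ((algebraMap K L a + algebraMap K L b * θ) * (algebraMap K L c + algebraMap K L d * θ)) =
      2 * (a * c + α * (b * d)) := by
    intro a b c d
    rw [← trace_add_mul_sqrt hθ hα h2 _ (a * d + b * c)]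
    congr 1
    simp only [map_add, map_mul]
    linear_combination (algebraMap K L b * algebraMap K L d) * hθ
  rw [Algebra.discr_def, Matrix.det_fin_two]
  simp only [Algebra.traceMatrix_apply, Algebra.traceForm_apply, h0, h1, hmul]
  ring

end QuadraticExtension

section IdealSquares

variable {R : Type*} [CommRing R] [IsDedekindDomain R]

lemma dvd_of_sq_dvd_sq {I J : Ideal R} (hI : I ≠ 0) (hJ : J ≠ 0) (h : I ^ 2 ∣ J ^ 2) : I ∣ J := by
  classical
  rw [UniqueFactorizationMonoid.dvd_iff_normalizedFactors_le_normalizedFactors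
    (pow_ne_zero _ hI) (pow_ne_zero _ hJ), UniqueFactorizationMonoid.normalizedFactors_pow,
    UniqueFactorizationMonoid.normalizedFactors_pow, Multiset.le_iff_count] at h
  rw [UniqueFactorizationMonoid.dvd_iff_normalizedFactors_le_normalizedFactors hI hJ,
    Multiset.le_iff_count]
  intro a
  have := h a
  simp only [Multiset.count_nsmul] at this
  omega

lemma mem_of_sq_mem_sq {I : Ideal R} {e : R} (h : e ^ 2 ∈ I ^ 2) : e ∈ I := by
  by_cases he : e = 0
  · simp [he]
  by_cases hI : I = 0
  · subst hI
    rw [zero_pow two_ne_zero] at h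
    exact absurd (pow_eq_zero_iff two_ne_zero |>.1 (by simpa using h)) he
  rw [← Ideal.dvd_span_singleton]
  refine dvd_of_sq_dvd_sq hI (by simpa using he) ?_
  rw [Ideal.span_singleton_pow, Ideal.dvd_span_singleton]
  exact h

end IdealSquares

section Link

variable {K : Type*} [Field K] [NumberField K] {L : Type*} [Field L] [Algebra K L]
  {α : Kˣ} {θ : L}

lemma exists_eq_prin_mul_mk0 (J : FracUnits K) :
    ∃ (x : Kˣ) (I : (Ideal (𝓞 K))⁰), J = prin x * FractionalIdeal.mk0 K I := by
  obtain ⟨a, I, ha, hI⟩ := FractionalIdeal.exists_eq_spanSingleton_mul (J : FractionalIdeal (𝓞 K)⁰ K)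
  have ha' : algebraMap _ K a ≠ 0 := by simpa using ha
  have hI0 : I ≠ 0 := by
    rintro rfl
    exact J.ne_zero (by rw [hI]; simp)
  refine ⟨Units.mk0 (algebraMap _ K a)⁻¹ (inv_ne_zero ha'), ⟨I, mem_nonZeroDivisors_of_ne_zero hI0⟩, ?_⟩
  ext1
  rw [Units.val_mul, coe_toPrincipalIdeal, FractionalIdeal.coe_mk0, hI]
  rfl

lemma mk_prin (x : Kˣ) : ClassGroup.mk K (prin x) = 1 := by
  rw [ClassGroup.mk_eq_one_iff, coe_toPrincipalIdeal]
  exact ⟨⟨x, by simp⟩⟩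

/-- The elements of a quadratic extension which are integral over `𝓞 K`, in terms of a slope. -/
lemma isIntegral_slope_iff (hθ : θ ^ 2 = algebraMap K L α) (hα : ¬ IsSquare (α : K))
    (h2 : Module.finrank K L = 2) {σ : K}
    (hσ : ∀ w ∈ (sqIdeal α : FractionalIdeal (𝓞 K)⁰ K), IsSqRep (α : K) w (w * σ)) (z : L) :
    IsIntegral ℤ z ↔ ∃ u : 𝓞 K, ∃ w ∈ (sqIdeal α : FractionalIdeal (𝓞 K)⁰ K),
      z = algebraMap K L ((2 * algebraMap _ K u + w * σ) / 2) + algebraMap K L (w / 2) * θ := by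
  constructor
  · intro hz
    obtain ⟨t, w, rfl⟩ := exists_eq_half hθ hα h2 z
    rw [isIntegral_half_iff hθ hα h2] at hz
    have hw : w ∈ (sqIdeal α : FractionalIdeal (𝓞 K)⁰ K) := mem_sqIdeal.2 hz.mem
    obtain ⟨⟨y, hy⟩, r, hr⟩ := hz.add ((hσ w hw).smul (-1))
    obtain ⟨u, hu⟩ := exists_integer_of_sq r ((t - w * σ) / 2) (by
      simp only [map_neg, map_one] at hr
      linear_combination (1 / 4 : K) * hr)
    exact ⟨u, w, hw, by rw [hu]; congr 2; ring⟩
  · rintro ⟨u, w, hw, rfl⟩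
    rw [isIntegral_half_iff hθ hα h2]
    have h0 : IsSqRep (α : K) 0 (2 * algebraMap _ K u) :=
      ⟨⟨2 * u, by simp only [map_mul, map_ofNat]⟩, u ^ 2, by rw [map_pow]; ring⟩
    simpa using h0.add (hσ w hw)

theorem isSteinitzClass_iff (hθ : θ ^ 2 = algebraMap K L α) (hα : ¬ IsSquare (α : K))
    (h2 : Module.finrank K L = 2) (𝒞 : ClassGroup (𝓞 K)) :
    IsSteinitzClass K L 𝒞 ↔ ClassGroup.mk K (sqIdeal α) = 𝒞 := by
  obtain ⟨x, I, hxI⟩ := exists_eq_prin_mul_mk0 (sqIdeal α)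
  obtain ⟨σ, hσ⟩ := exists_slope α
  have hclass : ClassGroup.mk K (sqIdeal α) = ClassGroup.mk0 I := by
    rw [hxI, map_mul, mk_prin, one_mul, ClassGroup.mk_mk0]
  let F : (𝓞 K × (I : Ideal (𝓞 K))) →ₗ[𝓞 K] L :=
    { toFun := fun p => algebraMap K L ((2 * algebraMap _ K p.1 + (x * algebraMap _ K (p.2 : 𝓞 K)) * σ) / 2) +
        algebraMap K L ((x * algebraMap _ K (p.2 : 𝓞 K)) / 2) * θ
      map_add' := fun p q => by
        simp only [Prod.fst_add, Prod.snd_add, Submodule.coe_add, map_add, map_mul, map_div₀]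
        ring
      map_smul' := fun c p => by
        simp only [Prod.smul_fst, Prod.smul_snd, Submodule.coe_smul, smul_eq_mul, map_add, map_mul,
          map_div₀, Algebra.smul_def, RingHom.id_apply, IsScalarTower.algebraMap_apply (𝓞 K) K L]
        ring }
  have hF : ∀ p, F p = algebraMap K L ((2 * algebraMap _ K p.1 +
      (x * algebraMap _ K (p.2 : 𝓞 K)) * σ) / 2) +
        algebraMap K L ((x * algebraMap _ K (p.2 : 𝓞 K)) / 2) * θ := fun _ => rfl
  have hFinj : Function.Injective F := by
    intro p q h
    rw [hF, hF] at h
    obtain ⟨h1, h3⟩ := half_injective hθ hα h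
    have hpq : algebraMap _ K (p.2 : 𝓞 K) = algebraMap _ K (q.2 : 𝓞 K) := by
      have := x.ne_zero
      field_simp at h3
      exact h3
    rw [hpq] at h1
    ext1
    · apply FaithfulSMul.algebraMap_injective (𝓞 K) K
      linear_combination h1
    · exact Subtype.ext (FaithfulSMul.algebraMap_injective (𝓞 K) K hpq)
  have hrange : LinearMap.range F =
      LinearMap.range ((Algebra.linearMap (𝓞 L) L).restrictScalars (𝓞 K)) := by
    ext z
    have : z ∈ LinearMap.range ((Algebra.linearMap (𝓞 L) L).restrictScalars (𝓞 K)) ↔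
        IsIntegral ℤ z := by
      constructor
      · rintro ⟨y, rfl⟩
        exact y.2
      · intro h
        exact ⟨⟨z, h⟩, rfl⟩
    rw [this, isIntegral_slope_iff hθ hα h2 hσ]
    constructor
    · rintro ⟨p, rfl⟩
      refine ⟨p.1, x * algebraMap _ K (p.2 : 𝓞 K), ?_, rfl⟩
      rw [hxI, mem_prin_mul]
      simp
    · rintro ⟨u, w, hw, rfl⟩
      rw [hxI, mem_prin_mul] at hw
      simp only [FractionalIdeal.coe_mk0, FractionalIdeal.mem_coeIdeal] at hw
      obtain ⟨i, hi, hiw⟩ := hw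
      refine ⟨(u, ⟨i, hi⟩), ?_⟩
      rw [hF]
      simp only [hiw]
      simp
  have hinj2 : Function.Injective ((Algebra.linearMap (𝓞 L) L).restrictScalars (𝓞 K)) :=
    FaithfulSMul.algebraMap_injective (𝓞 L) L
  let E : (𝓞 K × (I : Ideal (𝓞 K))) ≃ₗ[𝓞 K] 𝓞 L :=
    (LinearEquiv.ofInjective F hFinj).trans ((LinearEquiv.ofEq _ _ hrange).trans
      (LinearEquiv.ofInjective _ hinj2).symm)
  have h1 : Module.finrank K L - 1 = 1 := by omega
  let G : (Fin (Module.finrank K L - 1) → 𝓞 K) ≃ₗ[𝓞 K] 𝓞 K :=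
    (LinearEquiv.funCongrLeft (𝓞 K) (𝓞 K) (finCongr h1.symm)).trans
      (LinearEquiv.funUnique (Fin 1) (𝓞 K) (𝓞 K))
  rw [hclass]
  constructor
  · rintro ⟨J, rfl, ⟨e⟩⟩
    exact mk0_eq_of_prod_equiv I J (E.trans (e.trans (G.prodCongr (LinearEquiv.refl _ _))))
  · rintro rfl
    exact ⟨I, rfl, ⟨E.symm.trans (G.symm.prodCongr (LinearEquiv.refl _ _))⟩⟩

theorem coe_relDisc (hθ : θ ^ 2 = algebraMap K L α) (hα : ¬ IsSquare (α : K))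
    (h2 : Module.finrank K L = 2) :
    (relDisc K L : FractionalIdeal (𝓞 K)⁰ K) = (prin α * sqIdeal α ^ 2 : FracUnits K) := by
  obtain ⟨σ, hσ⟩ := exists_slope α
  have hmem : ∀ w ∈ (sqIdeal α : FractionalIdeal (𝓞 K)⁰ K), ∀ y : 𝓞 K,
      algebraMap _ K y = α * w ^ 2 → y ∈ relDisc K L := by
    intro w hw y hy
    by_cases hw0 : w = 0
    · rw [hw0] at hy
      have : y = 0 := by simpa using hy
      rw [this]; exact zero_mem _
    refine Ideal.subset_span ?_
    set v : L := algebraMap K L ((w * σ) / 2) + algebraMap K L (w / 2) * θ with hv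
    have hli : LinearIndependent K ![(1 : L), v] := by
      have hli := linearIndependent_one_sqrt hθ hα
      rw [LinearIndependent.pair_iff] at hli ⊢
      intro s t h
      have := hli (s + t * (w * σ / 2)) (t * (w / 2)) (by
        rw [← h, hv]
        simp only [Algebra.smul_def, map_add, map_mul, map_div₀]
        ring)
      have ht : t = 0 := by simpa [hw0] using this.2
      subst ht
      simpa using this.1
    let b₀ : Module.Basis (Fin 2) K L :=
      basisOfLinearIndependentOfCardEqFinrank hli (by simp [h2])
    have hb₀ : ⇑b₀ = ![(1 : L), v] := by simp [b₀]
    refine ⟨b₀.reindex (finCongr h2.symm), ?_, ?_⟩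
    · intro i
      rw [Module.Basis.reindex_apply, hb₀]
      generalize (finCongr h2.symm).symm i = j
      fin_cases j
      · exact isIntegral_one
      · exact (isIntegral_slope_iff hθ hα h2 hσ _).2 ⟨0, w, hw, by simp [hv]⟩
    · rw [Module.Basis.coe_reindex, Algebra.discr_reindex, hb₀,
        discr_pair hθ hα h2 2 0 (w * σ) w _ (by simp) (by simp [hv]), hy]
      ring
  apply le_antisymm
  · have hle : relDisc K L ≤ Submodule.comap (Algebra.linearMap (𝓞 K) K)
        (((prin α * sqIdeal α ^ 2 : FracUnits K) : FractionalIdeal (𝓞 K)⁰ K) :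
          Submodule (𝓞 K) K) := by
      refine Ideal.span_le.2 ?_
      rintro d ⟨b, hb, hd⟩
      obtain ⟨u, w, hw, h0⟩ := (isIntegral_slope_iff hθ hα h2 hσ _).1 (hb (finCongr h2.symm 0))
      obtain ⟨u', w', hw', h1⟩ := (isIntegral_slope_iff hθ hα h2 hσ _).1 (hb (finCongr h2.symm 1))
      have hdisc := discr_pair hθ hα h2 _ _ _ _ (⇑b ∘ (finCongr h2.symm)) h0 h1
      rw [← Equiv.symm_symm (finCongr h2.symm), Algebra.discr_reindex, ← hd] at hdisc
      have hv : algebraMap _ K u * w' - algebraMap _ K u' * w ∈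
          (sqIdeal α : FractionalIdeal (𝓞 K)⁰ K) := by
        simp only [← Algebra.smul_def]
        exact Submodule.sub_mem _ (Submodule.smul_mem _ _ hw') (Submodule.smul_mem _ _ hw)
      change algebraMap _ K d ∈ ((prin α * sqIdeal α ^ 2 : FracUnits K) : FractionalIdeal (𝓞 K)⁰ K)
      rw [mem_prin_mul, hdisc]
      have := mul_mul_mem_one hv hv (le_of_eq (sq (sqIdeal α)).symm)
      convert this using 1
      have := α.ne_zero
      field_simp
      ring
    intro z hz
    obtain ⟨d, hd, rfl⟩ := (FractionalIdeal.mem_coeIdeal _).1 hz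
    exact hle hd
  · rw [sq, Units.val_mul, Units.val_mul, coe_toPrincipalIdeal,
      FractionalIdeal.spanSingleton_mul_le_iff]
    intro z hz
    refine FractionalIdeal.mul_induction_on hz (fun i hi j hj => ?_) (fun x y hx hy => ?_)
    · obtain ⟨e, he⟩ := exists_integer_mul_mul (mem_sqIdeal.1 hi) (mem_sqIdeal.1 hj)
      obtain ⟨a, ha⟩ := (mem_sqIdeal.1 hi).exists_integer
      obtain ⟨b, hb⟩ := (mem_sqIdeal.1 hj).exists_integer
      rw [FractionalIdeal.mem_coeIdeal]
      refine ⟨e, ?_, by rw [he]; ring⟩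
      apply mem_of_sq_mem_sq
      have : e ^ 2 = a * b := by
        apply FaithfulSMul.algebraMap_injective (𝓞 K) K
        rw [map_pow, map_mul, ha, hb, he]; ring
      rw [this, sq]
      exact Ideal.mul_mem_mul (hmem i hi a ha) (hmem j hj b hb)
    · rw [mul_add]
      exact Submodule.add_mem _ hx hy

end Link

section Fields

variable {K : Type*} [Field K] [NumberField K]

open IntermediateField

/-- A square root of `α` in the algebraic closure. -/
def sqrtOf (α : Kˣ) : AlgebraicClosure K :=
  (IsAlgClosed.exists_pow_nat_eq (algebraMap K (AlgebraicClosure K) α) two_pos).choose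

lemma sqrtOf_sq (α : Kˣ) : sqrtOf α ^ 2 = algebraMap K (AlgebraicClosure K) α :=
  (IsAlgClosed.exists_pow_nat_eq (algebraMap K (AlgebraicClosure K) α) two_pos).choose_spec

/-- The field obtained by adjoining a square root of `α`. -/
def sqrtField (α : Kˣ) : IntermediateField K (AlgebraicClosure K) := K⟮sqrtOf α⟯

/-- The square root of `α` as an element of `sqrtField α`. -/
def sqrtGen (α : Kˣ) : sqrtField α := AdjoinSimple.gen K (sqrtOf α)

lemma sqrtGen_sq (α : Kˣ) : sqrtGen α ^ 2 = algebraMap K (sqrtField α) α := by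
  apply Subtype.ext
  have : ((sqrtGen α : sqrtField α) : AlgebraicClosure K) = sqrtOf α :=
    AdjoinSimple.coe_gen K _
  rw [SubmonoidClass.coe_pow, this, sqrtOf_sq]
  rfl

lemma mem_of_sq_eq {L : IntermediateField K (AlgebraicClosure K)} {x y : AlgebraicClosure K}
    (h : x ^ 2 = y ^ 2) (hy : y ∈ L) : x ∈ L := by
  rcases sq_eq_sq_iff_eq_or_eq_neg.1 h with rfl | rfl
  · exact hy
  · exact neg_mem hy

lemma sqrtField_le_iff {α : Kˣ} {L : IntermediateField K (AlgebraicClosure K)} :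
    sqrtField α ≤ L ↔ sqrtOf α ∈ L := by
  rw [sqrtField, adjoin_simple_le_iff]

lemma sqrtField_mul_sq (α s : Kˣ) : sqrtField (α * s ^ 2) = sqrtField α := by
  have h : sqrtOf (α * s ^ 2) ^ 2 = (algebraMap K _ (s : K) * sqrtOf α) ^ 2 := by
    rw [sqrtOf_sq, mul_pow, sqrtOf_sq]
    simp only [Units.val_mul, Units.val_pow_eq_pow_val, map_mul, map_pow]
    ring
  have h' : sqrtOf α ^ 2 = (algebraMap K _ (s⁻¹ : K) * sqrtOf (α * s ^ 2)) ^ 2 := by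
    rw [mul_pow, h, mul_pow, ← mul_assoc, ← mul_pow, ← map_mul, inv_mul_cancel₀ s.ne_zero]
    simp
  apply le_antisymm
  · rw [sqrtField_le_iff]
    exact mem_of_sq_eq h (mul_mem (IntermediateField.algebraMap_mem _ _) (mem_adjoin_simple_self K _))
  · rw [sqrtField_le_iff]
    exact mem_of_sq_eq h' (mul_mem (IntermediateField.algebraMap_mem _ _) (mem_adjoin_simple_self K _))

lemma sqrtField_eq_bot_iff {α : Kˣ} : sqrtField α = ⊥ ↔ IsSquare (α : K) := by
  rw [← le_bot_iff, sqrtField_le_iff, IntermediateField.mem_bot]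
  constructor
  · rintro ⟨x, hx⟩
    refine ⟨x, (algebraMap K (AlgebraicClosure K)).injective ?_⟩
    rw [← sqrtOf_sq, ← hx, map_mul, sq]
  · rintro ⟨x, hx⟩
    rw [← IntermediateField.mem_bot]
    refine mem_of_sq_eq (y := algebraMap K _ x) ?_ (IntermediateField.algebraMap_mem _ _)
    rw [sqrtOf_sq, hx, map_mul, sq]

lemma finrank_sqrtField {α : Kˣ} (hα : ¬ IsSquare (α : K)) :
    Module.finrank K (sqrtField α) = 2 := by
  have hirr : Irreducible (Polynomial.X ^ 2 - Polynomial.C (α : K)) :=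
    X_pow_sub_C_irreducible_of_prime Nat.prime_two
      (fun b hb => hα ⟨b, by rw [← hb, sq]⟩)
  have hmin := minpoly.eq_of_irreducible_of_monic hirr (x := sqrtOf α)
    (by simp [sqrtOf_sq]) (Polynomial.monic_X_pow_sub_C _ two_ne_zero)
  rw [sqrtField, adjoin.finrank (Algebra.IsIntegral.isIntegral _), ← hmin,
    Polynomial.natDegree_X_pow_sub_C]

lemma sqrtField_eq_iff {α β : Kˣ} : sqrtField α = sqrtField β ↔ ∃ s : Kˣ, β = α * s ^ 2 := by
  constructor
  · intro h
    by_cases hα : IsSquare (α : K)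
    · have hβ := hα
      rw [← sqrtField_eq_bot_iff, h, sqrtField_eq_bot_iff] at hβ
      obtain ⟨a, ha⟩ := hα
      obtain ⟨b, hb⟩ := hβ
      have ha0 : a ≠ 0 := by rintro rfl; simp at ha
      have hb0 : b ≠ 0 := by rintro rfl; simp at hb
      refine ⟨Units.mk0 (b / a) (div_ne_zero hb0 ha0), Units.ext ?_⟩
      simp only [Units.val_mul, Units.val_pow_eq_pow_val, Units.val_mk0, ha, hb]
      field_simp
    · have hβ := hα
      rw [← sqrtField_eq_bot_iff, h, sqrtField_eq_bot_iff] at hβ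
      have hmem : sqrtOf β ∈ sqrtField α := by
        rw [h]; exact mem_adjoin_simple_self K _
      have hη : (⟨sqrtOf β, hmem⟩ : sqrtField α) ^ 2 = algebraMap K (sqrtField α) β :=
        Subtype.ext (sqrtOf_sq β)
      have h2 := finrank_sqrtField hα
      have htr := trace_sqrt hη hβ h2
      obtain ⟨t, w, htw⟩ := exists_eq_half (sqrtGen_sq α) hα h2 ⟨sqrtOf β, hmem⟩
      rw [htw, trace_add_mul_sqrt (sqrtGen_sq α) hα h2] at htr
      have ht : t = 0 := by linear_combination htr
      subst ht
      rw [htw] at hη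
      have hβα : (α : K) * (w / 2) ^ 2 = β := by
        apply (algebraMap K (sqrtField α)).injective
        rw [← hη, map_mul, ← sqrtGen_sq]
        simp
        ring
      have hw : w / 2 ≠ 0 := by
        intro hw
        rw [hw] at hβα
        simp at hβα
        exact β.ne_zero hβα.symm
      exact ⟨Units.mk0 (w / 2) hw, Units.ext (by simpa using hβα.symm)⟩
  · rintro ⟨s, rfl⟩
    exact (sqrtField_mul_sq α s).symm

lemma exists_sqrtField_eq {L : IntermediateField K (AlgebraicClosure K)}
    (h2 : Module.finrank K L = 2) : ∃ α : Kˣ, ¬ IsSquare (α : K) ∧ sqrtField α = L := by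
  have : FiniteDimensional K L := Module.finite_of_finrank_pos (by omega)
  obtain ⟨x, hxL, hx⟩ : ∃ x ∈ L, x ∉ (⊥ : IntermediateField K (AlgebraicClosure K)) := by
    by_contra! hcon
    have : L = ⊥ := le_bot_iff.1 hcon
    rw [this, IntermediateField.finrank_bot] at h2
    omega
  have hp0 : minpoly K (⟨x, hxL⟩ : L) ≠ 0 :=
    minpoly.ne_zero (Algebra.IsIntegral.isIntegral _)
  have hdeg : (minpoly K (⟨x, hxL⟩ : L)).natDegree ≤ 2 := h2 ▸ minpoly.natDegree_le _
  have hpx := minpoly.aeval K (⟨x, hxL⟩ : L)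
  obtain ⟨a, b, c, hp⟩ : ∃ a b c : K, minpoly K (⟨x, hxL⟩ : L) =
      Polynomial.C a * Polynomial.X ^ 2 + Polynomial.C b * Polynomial.X + Polynomial.C c :=
    ⟨_, _, _, Polynomial.eq_quadratic_of_degree_le_two
      (Polynomial.natDegree_le_iff_degree_le.1 hdeg)⟩
  rw [hp] at hpx hp0
  have hpx' : algebraMap K (AlgebraicClosure K) a * x ^ 2 + algebraMap K _ b * x +
      algebraMap K _ c = 0 := by
    have := congrArg (algebraMap L (AlgebraicClosure K)) hpx
    simpa using this
  have hlin : ∀ r s : K, algebraMap K (AlgebraicClosure K) r * x = algebraMap K _ s → r = 0 := by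
    intro r s hrs
    by_contra hr
    apply hx
    have hr' : algebraMap K (AlgebraicClosure K) r ≠ 0 := by simpa using hr
    have : x = algebraMap K _ (s / r) := by
      rw [map_div₀, ← hrs]; field_simp
    rw [this]
    exact IntermediateField.algebraMap_mem _ _
  have ha : a ≠ 0 := by
    rintro rfl
    have hb : b = 0 := hlin b (-c) (by
      rw [map_neg]
      rw [map_zero] at hpx'
      linear_combination hpx')
    subst hb
    have hc : c = 0 := by simpa using hpx'
    subst hc
    simp at hp0
  have hsq : (algebraMap K (AlgebraicClosure K) (2 * a) * x + algebraMap K _ b) ^ 2 =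
      algebraMap K _ (b ^ 2 - 4 * a * c) := by
    simp only [map_mul, map_sub, map_pow, map_ofNat]
    linear_combination (4 * algebraMap K (AlgebraicClosure K) a) * hpx'
  have hnsq : ¬ IsSquare (b ^ 2 - 4 * a * c) := by
    rintro ⟨s, hs⟩
    have h1 := mem_of_sq_eq (L := ⊥) (x := algebraMap K (AlgebraicClosure K) (2 * a) * x +
      algebraMap K _ b) (y := algebraMap K _ s) (by rw [hsq, hs, map_mul, sq])
      (IntermediateField.algebraMap_mem _ _)
    obtain ⟨y, hy⟩ := IntermediateField.mem_bot.1 h1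
    have := hlin (2 * a) (y - b) (by rw [map_sub, hy]; ring)
    simp [ha] at this
  have h0 : b ^ 2 - 4 * a * c ≠ 0 := by
    intro h
    exact hnsq (by rw [h]; exact IsSquare.zero)
  refine ⟨Units.mk0 _ h0, hnsq, ?_⟩
  apply eq_of_le_of_finrank_eq
  · rw [sqrtField_le_iff]
    refine mem_of_sq_eq (y := algebraMap K (AlgebraicClosure K) (2 * a) * x +
      algebraMap K _ b) (by rw [sqrtOf_sq, hsq, Units.val_mk0]) ?_
    exact add_mem (mul_mem (IntermediateField.algebraMap_mem _ _) hxL) (IntermediateField.algebraMap_mem _ _)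
  · rw [h2]
    exact finrank_sqrtField hnsq

end Fields

section LatticePoints

open MeasureTheory Topology Pointwise Metric

variable {E : Type*} [NormedAddCommGroup E] [NormedSpace ℝ E]

lemma mem_cthickening_frontier {A : Set E} {p q : E} {δ : ℝ}
    (hpq : ¬ (p ∈ A ↔ q ∈ A)) (hδ : dist p q ≤ δ) : q ∈ cthickening δ (frontier A) := by
  obtain ⟨y, hy, hyA⟩ : ∃ y ∈ segment ℝ p q, y ∈ frontier A := by
    by_contra! hcon
    have hsub : segment ℝ p q ⊆ interior A ∪ interior Aᶜ := by
      intro y hy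
      have := hcon y hy
      rw [frontier, Set.mem_sdiff, not_and, not_not] at this
      by_cases hyc : y ∈ closure A
      · exact Or.inl (this hyc)
      · right; rwa [interior_compl]
    have hdisj : Disjoint (interior A) (interior Aᶜ) :=
      Set.disjoint_left.2 fun y h1 h2 => (interior_subset h2) (interior_subset h1)
    rcases (convex_segment p q).isPreconnected.subset_or_subset isOpen_interior isOpen_interior
      hdisj hsub with h | h
    · exact hpq (iff_of_true (interior_subset (h (left_mem_segment ℝ p q)))
        (interior_subset (h (right_mem_segment ℝ p q))))
    · exact hpq (iff_of_false (interior_subset (h (left_mem_segment ℝ p q)))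
        (interior_subset (h (right_mem_segment ℝ p q))))
  refine mem_cthickening_of_dist_le q y δ _ hyA (le_trans ?_ hδ)
  rw [dist_comm q y, dist_comm p q]
  have := dist_add_dist_of_mem_segment hy
  rw [dist_comm q p]
  linarith [dist_nonneg (x := p) (y := y)]

variable [FiniteDimensional ℝ E] [MeasurableSpace E] [BorelSpace E]
  (L : Submodule ℤ E) [DiscreteTopology L] [IsZLattice ℝ L]
  (μ : Measure E) [Measure.IsAddHaarMeasure μ]

lemma finite_coset_inter {D : Set E} (hD : Bornology.IsBounded D) (x₀ : E) {T : ℝ} (hT : 0 < T) :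
    {x : E | x ∈ L ∧ T⁻¹ • (x₀ + x) ∈ D}.Finite := by
  have hb : Bornology.IsBounded {x : E | T⁻¹ • (x₀ + x) ∈ D} := by
    obtain ⟨R, hR⟩ := hD.exists_norm_le
    refine isBounded_iff_forall_norm_le.2 ⟨T * R + ‖x₀‖, fun x hx => ?_⟩
    have h1 := hR _ hx
    rw [norm_smul, norm_inv, Real.norm_of_nonneg hT.le, inv_mul_le_iff₀ hT] at h1
    have h2 : ‖x‖ ≤ ‖x₀ + x‖ + ‖x₀‖ := by
      have := norm_sub_le (x₀ + x) x₀
      simpa using this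
    linarith
  have := Metric.finite_isBounded_inter_isClosed (s := (L : Set E)) DiscreteTopology.isDiscrete hb
    (inferInstanceAs (IsClosed (L.toAddSubgroup : Set E)))
  refine this.subset fun x hx => ⟨hx.2, hx.1⟩

/-- Points of a coset of a lattice in a dilated domain: the count is asymptotic to the volume. -/
theorem tendsto_coset_card_div_pow {D : Set E} (hDb : Bornology.IsBounded D)
    (hDf : μ (frontier D) = 0) (x₀ : E) :
    Tendsto (fun T : ℝ => ({x : E | x ∈ L ∧ T⁻¹ • (x₀ + x) ∈ D}.ncard : ℝ) /
      T ^ (Module.finrank ℝ E)) atTop (𝓝 (μ.real D / ZLattice.covolume L μ)) := by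
  set n := Module.finrank ℝ E with hn
  set b := (Module.Free.chooseBasis ℤ L).ofZLatticeBasis ℝ with hb
  set F := ZSpan.fundamentalDomain b with hF
  have hcov : ZLattice.covolume L μ = μ.real F :=
    ZLattice.covolume_eq_measure_fundamentalDomain L μ (ZLattice.isAddFundamentalDomain _ μ)
  have hcov0 : 0 < ZLattice.covolume L μ := ZLattice.covolume_pos L μ
  have hFb : Bornology.IsBounded F := ZSpan.fundamentalDomain_isBounded b
  have hFm : MeasurableSet F := ZSpan.fundamentalDomain_measurableSet b
  have hspan : Submodule.span ℤ (Set.range b) = L :=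
    (Module.Free.chooseBasis ℤ L).ofZLatticeBasis_span ℝ L
  have huniq : ∀ y : E, ∃! v : Submodule.span ℤ (Set.range b), v +ᵥ y ∈ F := fun y =>
    ZSpan.exist_unique_vadd_mem_fundamentalDomain b y
  obtain ⟨r, hr⟩ := hFb.exists_norm_le
  have hCfin : ∀ δ : ℝ, μ (cthickening δ (frontier D)) ≠ ⊤ := fun δ =>
    ((hDb.closure.subset frontier_subset_closure).cthickening).measure_lt_top.ne
  have hkey : ∀ T : ℝ, 0 < T →
      |({x : E | x ∈ L ∧ T⁻¹ • (x₀ + x) ∈ D}.ncard : ℝ) / T ^ n * μ.real F - μ.real D| ≤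
        μ.real (cthickening (r * T⁻¹) (frontier D)) := by
    intro T hT
    have hT' : 0 < T⁻¹ := inv_pos.2 hT
    have hfin := finite_coset_inter L hDb x₀ hT
    set s := hfin.toFinset with hs
    have hmem : ∀ x, x ∈ s ↔ x ∈ L ∧ T⁻¹ • (x₀ + x) ∈ D := fun x => by simp [hs]
    have hcard : {x : E | x ∈ L ∧ T⁻¹ • (x₀ + x) ∈ D}.ncard = s.card :=
      Set.ncard_eq_toFinset_card _ hfin
    let cell : E → Set E := fun x => T⁻¹ • ((x₀ + x) +ᵥ F)
    have hcellm : ∀ x, MeasurableSet (cell x) := fun x =>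
      (hFm.const_vadd _).const_smul₀ _
    have hcell : ∀ x y, y ∈ cell x ↔ -x + (T • y - x₀) ∈ F := by
      intro x y
      rw [Set.mem_smul_set_iff_inv_smul_mem₀ hT'.ne', inv_inv, Set.mem_vadd_set_iff_neg_vadd_mem,
        vadd_eq_add]
      congr! 1
      abel
    have hmeas : ∀ x, μ (cell x) = ENNReal.ofReal (T⁻¹ ^ n) * μ F := by
      intro x
      rw [Measure.addHaar_smul_of_nonneg _ hT'.le, measure_vadd]
    have hdisj : (s : Set E).PairwiseDisjoint cell := by
      intro x hx x' hx' hne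
      refine Set.disjoint_left.2 fun y hy hy' => hne ?_
      rw [hcell] at hy hy'
      have h1 : -x ∈ Submodule.span ℤ (Set.range b) := by
        rw [hspan]; exact neg_mem ((hmem x).1 hx).1
      have h2 : -x' ∈ Submodule.span ℤ (Set.range b) := by
        rw [hspan]; exact neg_mem ((hmem x').1 hx').1
      have := (huniq (T • y - x₀)).unique (y₁ := ⟨-x, h1⟩) (y₂ := ⟨-x', h2⟩) hy hy'
      simpa using this
    have hU : μ (⋃ x ∈ s, cell x) = s.card * (ENNReal.ofReal (T⁻¹ ^ n) * μ F) := by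
      rw [measure_biUnion_finset hdisj fun x _ => hcellm x]
      simp [hmeas]
    have hdist : ∀ x y, y ∈ cell x → dist (T⁻¹ • (x₀ + x)) y ≤ r * T⁻¹ := by
      intro x y hy
      rw [hcell] at hy
      have h1 := hr _ hy
      have h2 : y = T⁻¹ • (x₀ + x) + T⁻¹ • (-x + (T • y - x₀)) := by
        rw [← smul_add, show x₀ + x + (-x + (T • y - x₀)) = T • y by abel, inv_smul_smul₀ hT.ne']
      rw [dist_eq_norm, h2, sub_add_cancel_left, norm_neg, norm_smul, Real.norm_of_nonneg hT'.le,
        mul_comm]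
      gcongr
    have hsub1 : (⋃ x ∈ s, cell x) ⊆ D ∪ cthickening (r * T⁻¹) (frontier D) := by
      intro y hy
      simp only [Set.mem_iUnion] at hy
      obtain ⟨x, hx, hy⟩ := hy
      by_cases hyD : y ∈ D
      · exact Or.inl hyD
      · refine Or.inr (mem_cthickening_frontier (p := T⁻¹ • (x₀ + x)) ?_ (hdist x y hy))
        have := ((hmem x).1 hx).2
        tauto
    have hsub2 : D ⊆ (⋃ x ∈ s, cell x) ∪ cthickening (r * T⁻¹) (frontier D) := by
      intro y hyD
      obtain ⟨⟨v, hv⟩, hvF, -⟩ := huniq (T • y - x₀)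
      have hvL : -v ∈ L := by rw [← hspan]; exact neg_mem hv
      have hy : y ∈ cell (-v) := by
        rw [hcell, neg_neg]; exact hvF
      by_cases hx : T⁻¹ • (x₀ + -v) ∈ D
      · left
        simp only [Set.mem_iUnion]
        exact ⟨-v, (hmem _).2 ⟨hvL, hx⟩, hy⟩
      · refine Or.inr (mem_cthickening_frontier (p := T⁻¹ • (x₀ + -v)) ?_ (hdist _ y hy))
        tauto
    have hFfin : μ F ≠ ⊤ := hFb.measure_lt_top.ne
    have hDfin : μ D ≠ ⊤ := hDb.measure_lt_top.ne
    have hUreal : μ.real (⋃ x ∈ s, cell x) = s.card / T ^ n * μ.real F := by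
      rw [Measure.real, hU]
      simp only [ENNReal.toReal_mul, ENNReal.toReal_natCast, Measure.real]
      rw [ENNReal.toReal_ofReal (by positivity), inv_pow]
      ring
    have hUfin : μ (⋃ x ∈ s, cell x) ≠ ⊤ := by
      rw [hU]
      exact ENNReal.mul_ne_top (by simp) (ENNReal.mul_ne_top (by simp) hFfin)
    rw [hcard, ← hUreal, abs_le]
    have e1 := (measureReal_mono hsub1 (measure_union_ne_top hDfin (hCfin _))).trans
      (measureReal_union_le _ _)
    have e2 := (measureReal_mono hsub2 (measure_union_ne_top hUfin (hCfin _))).trans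
      (measureReal_union_le _ _)
    constructor <;> linarith
  have hlim : Tendsto (fun T : ℝ => μ.real (cthickening (r * T⁻¹) (frontier D))) atTop (𝓝 0) := by
    have h1 := tendsto_measure_cthickening_of_isClosed (μ := μ) ⟨1, one_pos, hCfin 1⟩
      (isClosed_frontier (s := D))
    rw [hDf] at h1
    have h2 : Tendsto (fun T : ℝ => r * T⁻¹) atTop (𝓝 0) := by
      simpa using tendsto_inv_atTop_zero.const_mul r
    have h3 := (ENNReal.tendsto_toReal ENNReal.zero_ne_top).comp (h1.comp h2)
    exact h3
  have hmain : Tendsto (fun T : ℝ => ({x : E | x ∈ L ∧ T⁻¹ • (x₀ + x) ∈ D}.ncard : ℝ) / T ^ n *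
      μ.real F) atTop (𝓝 (μ.real D)) := by
    rw [tendsto_iff_norm_sub_tendsto_zero]
    refine squeeze_zero' (Eventually.of_forall fun _ => norm_nonneg _) ?_ hlim
    filter_upwards [eventually_gt_atTop 0] with T hT using hkey T hT
  rw [hcov]
  rw [hcov] at hcov0
  have := hmain.div_const (μ.real F)
  simpa only [mul_div_cancel_right₀ _ hcov0.ne'] using this

end LatticePoints

section ConeCount

open mixedEmbedding MeasureTheory Topology

variable {K : Type*} [Field K] [NumberField K]

/-- The norm of a fractional ideal, as a real number. -/
def fnorm : FracUnits K →* ℝ :=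
  (Rat.castHom ℝ : ℚ →* ℝ).comp
    ((FractionalIdeal.absNorm (R := 𝓞 K) (K := K) : _ →* ℚ).comp (Units.coeHom _))

lemma fnorm_apply (I : FracUnits K) :
    fnorm I = ((FractionalIdeal.absNorm (I : FractionalIdeal (𝓞 K)⁰ K) : ℚ) : ℝ) := rfl

lemma fnorm_pos (I : FracUnits K) : 0 < fnorm I := by
  have h1 : 0 ≤ fnorm I := by
    rw [fnorm_apply]
    exact_mod_cast FractionalIdeal.absNorm_nonneg _
  refine h1.lt_of_ne' fun h => ?_
  have h2 : fnorm (I * I⁻¹) = 0 := by rw [map_mul, h, zero_mul]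
  simp at h2

lemma fnorm_mk0 (I : (Ideal (𝓞 K))⁰) :
    fnorm (FractionalIdeal.mk0 K I) = (Ideal.absNorm (I : Ideal (𝓞 K)) : ℝ) := by
  rw [fnorm_apply, FractionalIdeal.coe_mk0, FractionalIdeal.coeIdeal_absNorm]
  simp

lemma fnorm_prin (x : Kˣ) : fnorm (prin x) = mixedEmbedding.norm (mixedEmbedding K (x : K)) := by
  rw [fnorm_apply, coe_toPrincipalIdeal, FractionalIdeal.absNorm_span_singleton,
    mixedEmbedding.norm_eq_norm]

/-- The elements of `K` lying in the fundamental cone. -/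
def InCone (β : Kˣ) : Prop := mixedEmbedding K (β : K) ∈ fundamentalCone K

/-- The number of units of `K` in the cone, in a given coset of `J`, of norm at most `Y`. -/
def coneCoset (J : FracUnits K) (x₀ : K) (Y : ℝ) : Set Kˣ :=
  {β | InCone β ∧ (β : K) - x₀ ∈ (J : FractionalIdeal (𝓞 K)⁰ K) ∧ fnorm (prin β) ≤ Y}

lemma image_coneCoset (J : FracUnits K) (x₀ : K) {T : ℝ} (hT : 0 < T) :
    (fun β : Kˣ => mixedEmbedding K (β : K) - mixedEmbedding K x₀) ''
      coneCoset J x₀ (T ^ Module.finrank ℚ K) =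
    {x | x ∈ idealLattice K J ∧
      T⁻¹ • (mixedEmbedding K x₀ + x) ∈ fundamentalCone.normLeOne K} := by
  have hiff : ∀ β : K, T⁻¹ • mixedEmbedding K β ∈ fundamentalCone.normLeOne K ↔
      mixedEmbedding K β ∈ fundamentalCone K ∧
        mixedEmbedding.norm (mixedEmbedding K β) ≤ T ^ Module.finrank ℚ K := by
    intro β
    rw [fundamentalCone.mem_normLeOne, fundamentalCone.smul_mem_iff_mem (inv_ne_zero hT.ne'),
      mixedEmbedding.norm_smul, abs_of_pos (inv_pos.2 hT), inv_pow,
      inv_mul_le_iff₀ (by positivity), mul_one]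
  ext x
  constructor
  · rintro ⟨β, ⟨h1, h2, h3⟩, rfl⟩
    refine ⟨(mem_idealLattice K J).2 ⟨_, h2, map_sub _ _ _⟩, ?_⟩
    rw [add_sub_cancel, hiff]
    exact ⟨h1, by rwa [← fnorm_prin]⟩
  · rintro ⟨h1, h2⟩
    obtain ⟨y, hy, rfl⟩ := (mem_idealLattice K J).1 h1
    rw [← map_add, hiff] at h2
    have h0 : x₀ + y ≠ 0 := by
      intro h0
      rw [h0, map_zero] at h2
      exact h2.1.2 (by simp)
    refine ⟨Units.mk0 _ h0, ⟨h2.1, by simpa using hy, ?_⟩, by simp⟩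
    rw [fnorm_prin]
    exact h2.2

lemma sub_mixedEmbedding_injective (x₀ : K) :
    Function.Injective (fun β : Kˣ => mixedEmbedding K (β : K) - mixedEmbedding K x₀) :=
  fun _ _ h => Units.ext (mixedEmbedding_injective K (sub_left_injective h))

open scoped Classical in
lemma coneCoset_finite (J : FracUnits K) (x₀ : K) (Y : ℝ) : (coneCoset J x₀ Y).Finite := by
  have hd : Module.finrank ℚ K ≠ 0 := Module.finrank_pos.ne'
  have hle : Y ≤ (max Y 1) ^ Module.finrank ℚ K :=
    (le_max_left Y 1).trans (le_self_pow₀ (le_max_right Y 1) hd)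
  have hT : 0 < max Y 1 := lt_max_of_lt_right one_pos
  refine Set.Finite.subset (s := coneCoset J x₀ ((max Y 1) ^ Module.finrank ℚ K)) ?_
    fun β h => ⟨h.1, h.2.1, h.2.2.trans hle⟩
  refine Set.Finite.of_finite_image ?_ (sub_mixedEmbedding_injective x₀).injOn
  rw [image_coneCoset J x₀ hT]
  exact finite_coset_inter _ (fundamentalCone.isBounded_normLeOne K) _ hT

open scoped Classical in
variable (K) in
/-- The density of points of `𝓞 K` in the fundamental cone. -/
def coneDensity : ℝ :=
  (volume : Measure (mixedSpace K)).real (fundamentalCone.normLeOne K) /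
    (2⁻¹ ^ InfinitePlace.nrComplexPlaces K * √|(discr K : ℝ)|)

open scoped Classical in
theorem tendsto_coneCoset (J : FracUnits K) (x₀ : K) :
    Tendsto (fun Y : ℝ => ((coneCoset J x₀ Y).ncard : ℝ) / Y) atTop
      (𝓝 (coneDensity K / fnorm J)) := by
  have hd : Module.finrank ℚ K ≠ 0 := Module.finrank_pos.ne'
  have h := tendsto_coset_card_div_pow (idealLattice K J) (volume : Measure (mixedSpace K))
    (fundamentalCone.isBounded_normLeOne K) (fundamentalCone.volume_frontier_normLeOne K)
    (mixedEmbedding K x₀)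
  have hlim : (volume : Measure (mixedSpace K)).real (fundamentalCone.normLeOne K) /
      ZLattice.covolume (idealLattice K J) volume = coneDensity K / fnorm J := by
    rw [covolume_idealLattice, coneDensity, fnorm_apply, div_div]
    congr 1
    ring
  rw [hlim] at h
  have hd' : (0 : ℝ) < (Module.finrank ℚ K : ℝ)⁻¹ :=
    inv_pos.2 (Nat.cast_pos.2 (Nat.pos_of_ne_zero hd))
  have h2 := h.comp (tendsto_rpow_atTop hd')
  refine h2.congr' ?_
  filter_upwards [eventually_gt_atTop 0] with Y hY
  have hT : 0 < Y ^ (Module.finrank ℚ K : ℝ)⁻¹ := Real.rpow_pos_of_pos hY _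
  have hTY : (Y ^ (Module.finrank ℚ K : ℝ)⁻¹) ^ Module.finrank ℚ K = Y :=
    Real.rpow_inv_natCast_pow hY.le hd
  simp only [Function.comp]
  rw [mixedEmbedding.finrank, hTY, ← image_coneCoset J x₀ hT, hTY,
    Set.ncard_image_of_injective _ (sub_mixedEmbedding_injective x₀)]

end ConeCount

section Sieve

open IsDedekindDomain Topology

variable {K : Type*} [Field K] [NumberField K]

instance : IsOrderedMonoid (FracUnits K) where
  mul_le_mul_left a b h c := by
    rw [← Units.val_le_val] at h ⊢
    simp only [Units.val_mul]
    exact mul_le_mul_left h _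

/-- A prime ideal as an invertible fractional ideal. -/
def primeUnit (p : HeightOneSpectrum (𝓞 K)) : FracUnits K :=
  FractionalIdeal.mk0 K ⟨p.asIdeal, mem_nonZeroDivisors_of_ne_zero p.ne_bot⟩

lemma mk0_le_one (I : (Ideal (𝓞 K))⁰) : FractionalIdeal.mk0 K I ≤ 1 := by
  rw [← Units.val_le_val, FractionalIdeal.coe_mk0, Units.val_one]
  exact FractionalIdeal.coeIdeal_le_one

lemma mem_mk0 {I : (Ideal (𝓞 K))⁰} {x : 𝓞 K} :
    algebraMap _ K x ∈ (FractionalIdeal.mk0 K I : FractionalIdeal (𝓞 K)⁰ K) ↔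
      x ∈ (I : Ideal (𝓞 K)) := by
  rw [FractionalIdeal.coe_mk0, FractionalIdeal.mem_coeIdeal]
  constructor
  · rintro ⟨y, hy, hyx⟩
    rwa [← RingOfIntegers.coe_injective hyx]
  · exact fun h => ⟨x, h, rfl⟩

lemma exists_eq_mk0 {I : FracUnits K} (h : I ≤ 1) :
    ∃ J : (Ideal (𝓞 K))⁰, FractionalIdeal.mk0 K J = I := by
  rw [← Units.val_le_val, Units.val_one, FractionalIdeal.le_one_iff_exists_coeIdeal] at h
  obtain ⟨J, hJ⟩ := h
  refine ⟨⟨J, mem_nonZeroDivisors_of_ne_zero ?_⟩, Units.ext ?_⟩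
  · rintro rfl
    exact I.ne_zero (by rw [← hJ]; simp)
  · rw [FractionalIdeal.coe_mk0, hJ]

lemma mk0_le_mk0 {I J : (Ideal (𝓞 K))⁰} :
    FractionalIdeal.mk0 K I ≤ FractionalIdeal.mk0 K J ↔ (I : Ideal (𝓞 K)) ≤ J := by
  rw [← Units.val_le_val, FractionalIdeal.coe_mk0, FractionalIdeal.coe_mk0,
    FractionalIdeal.coeIdeal_le_coeIdeal]

lemma exists_le_primeUnit {I : FracUnits K} (h : I ≤ 1) (h1 : I ≠ 1) :
    ∃ p : HeightOneSpectrum (𝓞 K), I ≤ primeUnit p := by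
  obtain ⟨J, rfl⟩ := exists_eq_mk0 h
  have hJ : (J : Ideal (𝓞 K)) ≠ ⊤ := by
    intro hJ
    refine h1 ?_
    have : J = 1 := Subtype.ext (by simpa using hJ)
    rw [this, map_one]
  obtain ⟨m, hm, hle⟩ := Ideal.exists_le_maximal _ hJ
  refine ⟨⟨m, hm.isPrime, ?_⟩, mk0_le_mk0.2 hle⟩
  rintro rfl
  exact nonZeroDivisors.ne_zero J.2 (by simpa using hle)

/-- `a * w ^ 2` is an integral square modulo `4` for all `w ∈ 𝔠`. -/
def SqLe (𝔠 : FracUnits K) (a : K) : Prop :=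
  ∀ w ∈ (𝔠 : FractionalIdeal (𝓞 K)⁰ K), IsSqModFour (a * w ^ 2)

lemma sqLe_iff {𝔠 : FracUnits K} {α : Kˣ} : SqLe 𝔠 (α : K) ↔ 𝔠 ≤ sqIdeal α := by
  rw [← Units.val_le_val]
  rfl

lemma SqLe.mono {𝔠 𝔡 : FracUnits K} {a : K} (h : SqLe 𝔡 a) (hle : 𝔠 ≤ 𝔡) : SqLe 𝔠 a :=
  fun w hw => h w (hle hw)

/-- `𝔠` is contained in the ideal attached to `a`, and cannot be enlarged at the primes in `P`. -/
def Sieved (P : Set (HeightOneSpectrum (𝓞 K))) (𝔠 : FracUnits K) (a : K) : Prop :=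
  SqLe 𝔠 a ∧ ∀ p ∈ P, ¬ SqLe ((primeUnit p)⁻¹ * 𝔠) a

lemma sqIdeal_eq_iff {𝔠 : FracUnits K} {α : Kˣ} :
    sqIdeal α = 𝔠 ↔ Sieved Set.univ 𝔠 (α : K) := by
  constructor
  · rintro rfl
    refine ⟨sqLe_iff.2 le_rfl, fun p _ hp => ?_⟩
    rw [sqLe_iff, inv_mul_le_iff_le_mul, le_mul_iff_one_le_left', primeUnit,
      ← map_one (FractionalIdeal.mk0 K), mk0_le_mk0] at hp
    exact p.isPrime.ne_top (by simpa using hp)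
  · rintro ⟨h1, h2⟩
    by_contra hne
    rw [sqLe_iff] at h1
    obtain ⟨p, hp⟩ := exists_le_primeUnit (I := 𝔠 * (sqIdeal α)⁻¹)
      (by rwa [mul_inv_le_iff_le_mul, one_mul])
      (by rw [Ne, mul_inv_eq_one]; exact fun h => hne h.symm)
    refine h2 p trivial (sqLe_iff.2 ?_)
    rwa [inv_mul_le_iff_le_mul, ← mul_inv_le_iff_le_mul]

/-- The number four, as a unit. -/
def four : Kˣ := Units.mk0 4 (by norm_num)

lemma mem_prin_four {x : K} :
    x ∈ (prin (four : Kˣ) : FractionalIdeal (𝓞 K)⁰ K) ↔ ∃ s : 𝓞 K, x = 4 * algebraMap _ K s := by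
  have h := mem_prin_mul (x := (four : Kˣ)) (I := 1) (w := x)
  rw [mul_one, mem_one_fracUnits] at h
  rw [h]
  have h4 : (4 : K) ≠ 0 := by norm_num
  simp only [four, Units.val_mk0]
  constructor
  · rintro ⟨y, hy⟩
    exact ⟨y, by rw [hy]; field_simp⟩
  · rintro ⟨y, rfl⟩
    exact ⟨y, by field_simp⟩

lemma mul_sq_mem_prin_four {N 𝔠 : FracUnits K} (h : N * 𝔠 ^ 2 ≤ prin four) {y w : K}
    (hy : y ∈ (N : FractionalIdeal (𝓞 K)⁰ K)) (hw : w ∈ (𝔠 : FractionalIdeal (𝓞 K)⁰ K)) :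
    ∃ s : 𝓞 K, y * w ^ 2 = 4 * algebraMap _ K s := by
  refine mem_prin_four.1 (mul_mul_mem_one hy ?_ h)
  rw [sq w]
  exact mul_mul_mem_one hw hw (sq 𝔠).ge

lemma sqLe_add_iff {N 𝔠 : FracUnits K} (h : N * 𝔠 ^ 2 ≤ prin four) {a y : K}
    (hy : y ∈ (N : FractionalIdeal (𝓞 K)⁰ K)) : SqLe 𝔠 (a + y) ↔ SqLe 𝔠 a := by
  refine forall₂_congr fun w hw => ?_
  obtain ⟨s, hs⟩ := mul_sq_mem_prin_four h hy hw
  exact (isSqModFour_congr s (by rw [add_mul, hs])).symm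

lemma integer_mul_mem {I : FracUnits K} {x : K} (hx : x ∈ (I : FractionalIdeal (𝓞 K)⁰ K))
    (a : 𝓞 K) : algebraMap _ K a * x ∈ (I : FractionalIdeal (𝓞 K)⁰ K) := by
  rw [← Algebra.smul_def]
  exact Submodule.smul_mem (I : FractionalIdeal (𝓞 K)⁰ K).coeToSubmodule a hx

/-- `𝔠` is an integral ideal coprime to `M`. -/
def IntegralCoprime (M 𝔠 : FracUnits K) : Prop :=
  𝔠 ≤ 1 ∧ ∃ c : 𝓞 K, algebraMap _ K c ∈ (𝔠 : FractionalIdeal (𝓞 K)⁰ K) ∧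
    algebraMap _ K (c - 1) ∈ (M : FractionalIdeal (𝓞 K)⁰ K)

lemma sqLe_mul_iff {M 𝔠 𝔡 : FracUnits K} (hc : IntegralCoprime M 𝔠)
    (h : M * 𝔡 ^ 2 ≤ prin four) (a : 𝓞 K) :
    SqLe (𝔡 * 𝔠) (algebraMap _ K a) ↔ SqLe 𝔡 (algebraMap _ K a) := by
  obtain ⟨hc1, c, hc, hcM⟩ := hc
  refine ⟨fun h1 w hw => ?_, fun h1 => h1.mono (by simpa using mul_le_mul_right hc1 𝔡)⟩
  have h2 := h1 (w * algebraMap _ K c) (mul_mul_mem_one hw hc le_rfl)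
  obtain ⟨s, hs⟩ := mul_sq_mem_prin_four h (integer_mul_mem hcM (a * (c + 1))) hw
  refine (isSqModFour_congr s ?_).2 h2
  rw [← hs]
  simp only [map_mul, map_add, map_sub, map_one]
  ring

lemma exists_integralCoprime (M : FracUnits K) (hM : M ≤ 1) (𝒞 : ClassGroup (𝓞 K)) :
    ∃ 𝔠 : FracUnits K, IntegralCoprime M 𝔠 ∧ ClassGroup.mk K 𝔠 = 𝒞 := by
  obtain ⟨m, rfl⟩ := exists_eq_mk0 hM
  obtain ⟨J, hJ⟩ := ClassGroup.mk0_surjective 𝒞⁻¹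
  by_cases htop : (m : Ideal (𝓞 K)) = ⊤
  · obtain ⟨I, hI⟩ := ClassGroup.mk0_surjective 𝒞
    refine ⟨FractionalIdeal.mk0 K I, ⟨mk0_le_one I, 0, by simp, mem_mk0.2 (by simp [htop])⟩, ?_⟩
    rw [ClassGroup.mk_mk0, hI]
  have hJ0 : (J : Ideal (𝓞 K)) ≠ 0 := nonZeroDivisors.ne_zero J.2
  have hm0 : (m : Ideal (𝓞 K)) ≠ 0 := nonZeroDivisors.ne_zero m.2
  obtain ⟨a, ha⟩ := IsDedekindDomain.exists_sup_span_eq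
    (I := (J : Ideal (𝓞 K)) * (m : Ideal (𝓞 K))) (J := J) Ideal.mul_le_left (mul_ne_zero hJ0 hm0)
  have haJ : (J : Ideal (𝓞 K)) ∣ Ideal.span {a} := by
    rw [Ideal.dvd_iff_le]
    exact le_sup_right.trans ha.le
  obtain ⟨I, hI⟩ := haJ
  have hsup : (m : Ideal (𝓞 K)) ⊔ I = 1 := by
    rw [hI, ← Ideal.mul_sup] at ha
    exact mul_left_cancel₀ hJ0 (by rw [ha, mul_one])
  have hI0 : I ≠ 0 := by
    rintro rfl
    refine htop ?_
    simpa using hsup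
  let I' : (Ideal (𝓞 K))⁰ := ⟨I, mem_nonZeroDivisors_of_ne_zero hI0⟩
  have h1 : (1 : 𝓞 K) ∈ (m : Ideal (𝓞 K)) ⊔ I := by rw [hsup]; simp
  obtain ⟨y, hy, c, hc, hyc⟩ := Submodule.mem_sup.1 h1
  refine ⟨FractionalIdeal.mk0 K I', ⟨mk0_le_one _, c, mem_mk0.2 hc, mem_mk0.2 ?_⟩, ?_⟩
  · have : c - 1 = -y := by rw [← hyc]; ring
    rw [this]
    exact neg_mem hy
  · rw [ClassGroup.mk_mk0]
    have h2 : ClassGroup.mk0 (J * I') = 1 := by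
      rw [ClassGroup.mk0_eq_one_iff]
      exact ⟨⟨a, hI.symm⟩⟩
    rw [map_mul, hJ] at h2
    exact (inv_mul_eq_one.1 h2).symm

/-- The modulus for the sieve conditions at the primes in `P`. -/
def sieveModulus (P : Finset (HeightOneSpectrum (𝓞 K))) : FracUnits K :=
  prin four * (∏ p ∈ P, primeUnit p) ^ 2

lemma primeUnit_le_one (p : HeightOneSpectrum (𝓞 K)) : primeUnit p ≤ 1 := mk0_le_one _

lemma sieveModulus_le_four (P : Finset (HeightOneSpectrum (𝓞 K))) :
    sieveModulus P ≤ prin four :=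
  mul_le_of_le_one_right' (pow_le_one' (Finset.prod_le_one' fun p _ => primeUnit_le_one p) 2)

lemma sieveModulus_le_one (P : Finset (HeightOneSpectrum (𝓞 K))) : sieveModulus P ≤ 1 := by
  refine (sieveModulus_le_four P).trans fun x hx => ?_
  obtain ⟨s, rfl⟩ := mem_prin_four.1 hx
  exact mem_one_fracUnits.2 ⟨4 * s, by simp only [map_mul, map_ofNat]⟩

lemma sieveModulus_mul_le {P : Finset (HeightOneSpectrum (𝓞 K))} {p : HeightOneSpectrum (𝓞 K)}
    (hp : p ∈ P) : sieveModulus P * ((primeUnit p)⁻¹) ^ 2 ≤ prin four := by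
  classical
  rw [sieveModulus, mul_assoc, ← mul_pow]
  refine mul_le_of_le_one_right' (pow_le_one' ?_ 2)
  rw [mul_inv_le_iff_le_mul, one_mul, ← Finset.mul_prod_erase P _ hp]
  exact mul_le_of_le_one_right' (Finset.prod_le_one' fun p _ => primeUnit_le_one p)

lemma sieved_add_iff {P : Finset (HeightOneSpectrum (𝓞 K))} {𝔠 : FracUnits K} {a y : K}
    (hy : y ∈ ((sieveModulus P * (𝔠 ^ 2)⁻¹ : FracUnits K) : FractionalIdeal (𝓞 K)⁰ K)) :
    Sieved P 𝔠 (a + y) ↔ Sieved P 𝔠 a := by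
  refine and_congr (sqLe_add_iff ?_ hy) (forall₂_congr fun p hp => not_congr (sqLe_add_iff ?_ hy))
  · rw [inv_mul_cancel_right]
    exact sieveModulus_le_four P
  · rw [mul_pow, mul_comm (_ ^ 2) (𝔠 ^ 2), ← mul_assoc, inv_mul_cancel_right]
    exact sieveModulus_mul_le hp

lemma sieved_iff_one {P : Finset (HeightOneSpectrum (𝓞 K))} {𝔠 : FracUnits K}
    (hc : IntegralCoprime (sieveModulus P) 𝔠) (a : 𝓞 K) :
    Sieved P 𝔠 (algebraMap _ K a) ↔ Sieved P 1 (algebraMap _ K a) := by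
  refine and_congr ?_ (forall₂_congr fun p hp => not_congr ?_)
  · simpa using sqLe_mul_iff hc (𝔡 := 1) (by simpa using sieveModulus_le_four P) a
  · simpa using sqLe_mul_iff hc (sieveModulus_mul_le hp) a

lemma Sieved.mem {P : Set (HeightOneSpectrum (𝓞 K))} {𝔠 : FracUnits K} {α : Kˣ}
    (h : Sieved P 𝔠 (α : K)) : prin α * 𝔠 ^ 2 ≤ 1 :=
  (mul_le_mul_right (pow_le_pow_left' (sqLe_iff.1 h.1) 2) _).trans (prin_mul_sqIdeal_sq_le_one α)

lemma mem_of_prin_le {α : Kˣ} {I : FracUnits K} (h : prin α ≤ I) :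
    (α : K) ∈ (I : FractionalIdeal (𝓞 K)⁰ K) := by
  rw [← Units.val_le_val, coe_toPrincipalIdeal] at h
  exact h (FractionalIdeal.mem_spanSingleton_self _ _)

end Sieve

section SieveDensity

open IsDedekindDomain Topology

variable {K : Type*} [Field K] [NumberField K]

lemma frac_add_mem {I : FracUnits K} {x y : K} (hx : x ∈ (I : FractionalIdeal (𝓞 K)⁰ K))
    (hy : y ∈ (I : FractionalIdeal (𝓞 K)⁰ K)) : x + y ∈ (I : FractionalIdeal (𝓞 K)⁰ K) :=
  Submodule.add_mem (I : FractionalIdeal (𝓞 K)⁰ K).coeToSubmodule hx hy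

lemma frac_sub_mem {I : FracUnits K} {x y : K} (hx : x ∈ (I : FractionalIdeal (𝓞 K)⁰ K))
    (hy : y ∈ (I : FractionalIdeal (𝓞 K)⁰ K)) : x - y ∈ (I : FractionalIdeal (𝓞 K)⁰ K) :=
  Submodule.sub_mem (I : FractionalIdeal (𝓞 K)⁰ K).coeToSubmodule hx hy

/-- A system of representatives of `𝓞 K` modulo an ideal also represents `𝔠⁻²` modulo `M 𝔠⁻²`. -/
lemma existsUnique_coset {M 𝔠 : FracUnits K} (hc : IntegralCoprime M 𝔠) (m : (Ideal (𝓞 K))⁰)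
    (hm : FractionalIdeal.mk0 K m = M) {b : K}
    (hb : b ∈ (((𝔠 ^ 2)⁻¹ : FracUnits K) : FractionalIdeal (𝓞 K)⁰ K)) :
    ∃! q : 𝓞 K ⧸ (m : Ideal (𝓞 K)),
      b - algebraMap _ K (Quotient.out q) ∈
        ((M * (𝔠 ^ 2)⁻¹ : FracUnits K) : FractionalIdeal (𝓞 K)⁰ K) := by
  obtain ⟨hc1, c, hc, hcM⟩ := hc
  have hc2 : algebraMap _ K (c ^ 2) ∈ ((𝔠 ^ 2 : FracUnits K) : FractionalIdeal (𝓞 K)⁰ K) := by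
    rw [sq c, map_mul]
    exact mul_mul_mem_one hc hc (sq 𝔠).ge
  have hcM2 : algebraMap _ K (1 - c ^ 2) ∈ (M : FractionalIdeal (𝓞 K)⁰ K) := by
    have := integer_mul_mem hcM (-(c + 1))
    rw [← map_mul] at this
    convert this using 2
    ring
  have hle : M ≤ M * (𝔠 ^ 2)⁻¹ :=
    le_mul_of_one_le_right' (one_le_inv'.2 (pow_le_one' hc1 2))
  obtain ⟨y, hy⟩ := mem_one_fracUnits.1 (mul_mul_mem_one hc2 hb (by rw [mul_inv_cancel]))
  have hby : b - algebraMap _ K y ∈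
      ((M * (𝔠 ^ 2)⁻¹ : FracUnits K) : FractionalIdeal (𝓞 K)⁰ K) := by
    have h1 := mul_mul_mem_one hcM2 hb le_rfl
    convert h1 using 1
    rw [hy]
    simp only [map_sub, map_one, map_pow]
    ring
  refine ⟨Ideal.Quotient.mk _ y, ?_, fun q hq => ?_⟩
  · have h1 : y - Quotient.out (Ideal.Quotient.mk (m : Ideal (𝓞 K)) y) ∈ (m : Ideal (𝓞 K)) := by
      rw [← Ideal.Quotient.mk_eq_mk_iff_sub_mem]
      exact (Ideal.Quotient.mk_out _).symm
    have h2 := hle (hm ▸ mem_mk0.2 h1)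
    have h3 := frac_add_mem hby h2
    convert h3 using 1
    rw [map_sub]
    ring
  · have h1 : algebraMap _ K (y - Quotient.out q) ∈
        ((M * (𝔠 ^ 2)⁻¹ : FracUnits K) : FractionalIdeal (𝓞 K)⁰ K) := by
      have h3 := frac_sub_mem hq hby
      convert h3 using 1
      rw [map_sub]
      ring
    have h2 := mul_mul_mem_one hc2 h1 (M := M) (by rw [mul_comm, inv_mul_cancel_right])
    have h3 := integer_mul_mem hcM2 (y - Quotient.out q)
    have h4 : algebraMap _ K (y - Quotient.out q) ∈ (M : FractionalIdeal (𝓞 K)⁰ K) := by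
      convert frac_add_mem h2 h3 using 1
      simp only [map_sub, map_one, map_pow]
      ring
    rw [← hm, mem_mk0, ← Ideal.Quotient.mk_eq_mk_iff_sub_mem] at h4
    rw [h4]
    exact (Ideal.Quotient.mk_out q).symm

lemma fnorm_inv (I : FracUnits K) : fnorm I⁻¹ = (fnorm I)⁻¹ :=
  eq_inv_of_mul_eq_one_left (by rw [← map_mul, inv_mul_cancel, map_one])

/-- The residue classes satisfying the sieve conditions. -/
def goodResidues (P : Finset (HeightOneSpectrum (𝓞 K))) (m : Ideal (𝓞 K)) (u : (𝓞 K)ˣ) :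
    Set (𝓞 K ⧸ m) :=
  {q | Sieved (P : Set (HeightOneSpectrum (𝓞 K))) 1 (algebraMap _ K (u * Quotient.out q : 𝓞 K))}

/-- The elements of the cone whose multiple by `u` satisfies the sieve conditions. -/
def sievedCone (P : Set (HeightOneSpectrum (𝓞 K))) (𝔠 : FracUnits K) (u : (𝓞 K)ˣ) (X : ℝ) :
    Set Kˣ :=
  {β | InCone β ∧ Sieved P 𝔠 (algebraMap _ K (u : 𝓞 K) * β) ∧ fnorm (prin β * 𝔠 ^ 2) ≤ X}

lemma Sieved.mem_of_unit {P : Set (HeightOneSpectrum (𝓞 K))} {𝔠 : FracUnits K} {u : (𝓞 K)ˣ}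
    {β : Kˣ} (h : Sieved P 𝔠 (algebraMap _ K (u : 𝓞 K) * β)) :
    (β : K) ∈ (((𝔠 ^ 2)⁻¹ : FracUnits K) : FractionalIdeal (𝓞 K)⁰ K) := by
  have h1 : Sieved P 𝔠 ((Units.map (algebraMap (𝓞 K) K : 𝓞 K →* K) u * β : Kˣ) : K) := h
  have h2 := mem_of_prin_le (le_inv_iff_mul_le_one_right.2 h1.mem)
  have h3 := integer_mul_mem h2 ((u⁻¹ : (𝓞 K)ˣ) : 𝓞 K)
  convert h3 using 1
  rw [Units.val_mul, ← mul_assoc, Units.coe_map, MonoidHom.coe_coe, ← map_mul]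
  simp

lemma sievedCone_eq {P : Finset (HeightOneSpectrum (𝓞 K))} {𝔠 : FracUnits K}
    (hc : IntegralCoprime (sieveModulus P) 𝔠) (m : (Ideal (𝓞 K))⁰)
    (hm : FractionalIdeal.mk0 K m = sieveModulus P) (u : (𝓞 K)ˣ) (X : ℝ) :
    sievedCone P 𝔠 u X = ⋃ q : goodResidues P (m : Ideal (𝓞 K)) u,
      coneCoset (sieveModulus P * (𝔠 ^ 2)⁻¹) (algebraMap _ K (Quotient.out (q : 𝓞 K ⧸ (m : Ideal (𝓞 K)))))
        (X / fnorm 𝔠 ^ 2) := by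
  have hnorm : ∀ β : Kˣ, fnorm (prin β * 𝔠 ^ 2) ≤ X ↔ fnorm (prin β) ≤ X / fnorm 𝔠 ^ 2 := by
    intro β
    rw [map_mul, map_pow, le_div_iff₀ (pow_pos (fnorm_pos _) 2)]
  have key : ∀ (β : Kˣ) (q : 𝓞 K ⧸ (m : Ideal (𝓞 K))),
      (β : K) - algebraMap _ K (Quotient.out q) ∈
        ((sieveModulus P * (𝔠 ^ 2)⁻¹ : FracUnits K) : FractionalIdeal (𝓞 K)⁰ K) →
      (Sieved P 𝔠 (algebraMap _ K (u : 𝓞 K) * β) ↔ q ∈ goodResidues P (m : Ideal (𝓞 K)) u) := by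
    intro β q h
    have h1 := integer_mul_mem h (u : 𝓞 K)
    rw [goodResidues, Set.mem_ofPred_eq, ← sieved_iff_one hc,
      ← sieved_add_iff (a := algebraMap _ K (u * Quotient.out q : 𝓞 K)) h1, map_mul, ← mul_add, add_sub_cancel]
  ext β
  simp only [Set.mem_iUnion, Subtype.exists, exists_prop, sievedCone, Set.mem_ofPred_eq, hnorm]
  constructor
  · rintro ⟨h1, h2, h3⟩
    obtain ⟨q, hq, -⟩ := existsUnique_coset hc m hm h2.mem_of_unit
    exact ⟨q, (key β q hq).1 h2, h1, hq, h3⟩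
  · rintro ⟨q, hq, h1, h2, h3⟩
    exact ⟨h1, (key β q h2).2 hq, h3⟩

theorem tendsto_sievedCone {P : Finset (HeightOneSpectrum (𝓞 K))} {𝔠 : FracUnits K}
    (hc : IntegralCoprime (sieveModulus P) 𝔠) (m : (Ideal (𝓞 K))⁰)
    (hm : FractionalIdeal.mk0 K m = sieveModulus P) (u : (𝓞 K)ˣ) :
    Tendsto (fun X : ℝ => ((sievedCone P 𝔠 u X).ncard : ℝ) / X) atTop
      (𝓝 ((goodResidues P (m : Ideal (𝓞 K)) u).ncard * (coneDensity K / fnorm (sieveModulus P)))) := by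
  have hfin : Finite (𝓞 K ⧸ (m : Ideal (𝓞 K))) :=
    Ideal.finiteQuotientOfFreeOfNeBot _ (nonZeroDivisors.ne_zero m.2)
  have := Fintype.ofFinite (goodResidues P (m : Ideal (𝓞 K)) u)
  have hpos : 0 < fnorm 𝔠 ^ 2 := pow_pos (fnorm_pos _) 2
  have hcard : ∀ X, ((sievedCone P 𝔠 u X).ncard : ℝ) / X =
      ∑ q : goodResidues P (m : Ideal (𝓞 K)) u,
        (((coneCoset (sieveModulus P * (𝔠 ^ 2)⁻¹)
          (algebraMap _ K (Quotient.out (q : 𝓞 K ⧸ (m : Ideal (𝓞 K))))) (X / fnorm 𝔠 ^ 2)).ncard : ℝ) /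
            (X / fnorm 𝔠 ^ 2)) / fnorm 𝔠 ^ 2 := by
    intro X
    rw [sievedCone_eq hc m hm, Set.ncard_iUnion_of_finite (fun _ => coneCoset_finite _ _ _),
      finsum_eq_sum_of_fintype, Nat.cast_sum, Finset.sum_div]
    · refine Finset.sum_congr rfl fun q _ => ?_
      rw [div_div, div_mul_cancel₀ _ hpos.ne']
    · intro q q' hne
      refine Set.disjoint_left.2 fun β h h' => hne (Subtype.ext ?_)
      have hβ : (β : K) ∈ (((𝔠 ^ 2)⁻¹ : FracUnits K) : FractionalIdeal (𝓞 K)⁰ K) := by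
        have h1 : (1 : FracUnits K) ≤ (𝔠 ^ 2)⁻¹ := one_le_inv'.2 (pow_le_one' hc.1 2)
        have h2 := frac_add_mem (mul_le_of_le_one_left' (sieveModulus_le_one P) h.2.1)
          (h1 (mem_one_fracUnits.2 ⟨Quotient.out (q : 𝓞 K ⧸ (m : Ideal (𝓞 K))), rfl⟩))
        rwa [sub_add_cancel] at h2
      exact (existsUnique_coset hc m hm hβ).unique h.2.1 h'.2.1
  simp_rw [hcard]
  have hlim := tendsto_finsetSum (Finset.univ : Finset (goodResidues P (m : Ideal (𝓞 K)) u))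
    fun q _ => (((tendsto_coneCoset (sieveModulus P * (𝔠 ^ 2)⁻¹)
      (algebraMap _ K (Quotient.out (q : 𝓞 K ⧸ (m : Ideal (𝓞 K)))))).comp
        (tendsto_id.atTop_div_const hpos)).div_const (fnorm 𝔠 ^ 2))
  have hn1 := (fnorm_pos 𝔠).ne'
  have hn2 := (fnorm_pos (sieveModulus P)).ne'
  have heq : (goodResidues P (m : Ideal (𝓞 K)) u).ncard * (coneDensity K / fnorm (sieveModulus P))
      = ∑ _q : goodResidues P (m : Ideal (𝓞 K)) u,
        coneDensity K / fnorm (sieveModulus P * (𝔠 ^ 2)⁻¹) / fnorm 𝔠 ^ 2 := by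
    rw [Finset.sum_const, Finset.card_univ, ← Nat.card_eq_fintype_card, nsmul_eq_mul,
      Nat.card_coe_set_eq, map_mul, fnorm_inv, map_pow]
    field_simp
  rw [heq]
  exact hlim

end SieveDensity

section IdealPairs

open Topology

variable (K : Type*) [Field K] [NumberField K]

/-- The nonzero ideals of norm at most `Y`. -/
def idealsLe (Y : ℝ) : Set (Ideal (𝓞 K))⁰ := {I | (Ideal.absNorm (I : Ideal (𝓞 K)) : ℝ) ≤ Y}

/-- The nonzero ideals of norm `n`. -/
def idealsEq (n : ℕ) : Set (Ideal (𝓞 K))⁰ := {I | Ideal.absNorm (I : Ideal (𝓞 K)) = n}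

lemma one_le_absNorm (I : (Ideal (𝓞 K))⁰) : 1 ≤ Ideal.absNorm (I : Ideal (𝓞 K)) :=
  Nat.one_le_iff_ne_zero.2 (Ideal.absNorm_ne_zero_of_nonZeroDivisors I)

lemma idealsLe_finite (Y : ℝ) : (idealsLe K Y).Finite := by
  refine Set.Finite.subset (Ideal.finite_setOfPred_absNorm_le₀ (S := 𝓞 K) ⌊Y⌋₊) fun I hI => ?_
  exact Nat.le_floor hI

lemma idealsEq_finite (n : ℕ) : (idealsEq K n).Finite :=
  (idealsLe_finite K n).subset fun _ hI => (Nat.cast_le (α := ℝ)).2 (le_of_eq hI)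

lemma exists_idealsLe_le :
    ∃ C : ℝ, 0 ≤ C ∧ ∀ Y : ℝ, 0 ≤ Y → ((idealsLe K Y).ncard : ℝ) ≤ C * Y := by
  have hlim := NumberField.Ideal.tendsto_norm_le_div_atTop₀ K
  obtain ⟨Y₀, hY₀⟩ := eventually_atTop.1
    ((hlim.eventually (Iio_mem_nhds (lt_add_one _))).and (eventually_gt_atTop 0))
  set κ := (2 ^ InfinitePlace.nrRealPlaces K * (2 * Real.pi) ^ InfinitePlace.nrComplexPlaces K *
    Units.regulator K * classNumber K) / (Units.torsionOrder K * √|(discr K : ℝ)|) + 1 with hκ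
  refine ⟨max κ (idealsLe K Y₀).ncard, le_max_of_le_right (Nat.cast_nonneg _), fun Y hY => ?_⟩
  rcases lt_or_ge Y 1 with h1 | h1
  · have : idealsLe K Y = ∅ := by
      refine Set.eq_empty_of_forall_notMem fun I hI => ?_
      have h2 : (1 : ℝ) ≤ Ideal.absNorm (I : Ideal (𝓞 K)) := by exact_mod_cast one_le_absNorm K I
      exact absurd (h2.trans hI) (not_le.2 h1)
    rw [this, Set.ncard_empty, Nat.cast_zero]
    exact mul_nonneg (le_max_of_le_right (Nat.cast_nonneg _)) hY
  rcases le_or_gt Y₀ Y with h2 | h2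
  · obtain ⟨h3, h4⟩ := hY₀ Y h2
    have h5 : ((idealsLe K Y).ncard : ℝ) / Y < κ := h3
    rw [div_lt_iff₀ h4] at h5
    exact h5.le.trans (mul_le_mul_of_nonneg_right (le_max_left _ _) hY)
  · have h3 : (idealsLe K Y).ncard ≤ (idealsLe K Y₀).ncard :=
      Set.ncard_le_ncard (fun I hI => le_trans hI h2.le) (idealsLe_finite K Y₀)
    calc ((idealsLe K Y).ncard : ℝ) ≤ (idealsLe K Y₀).ncard := by exact_mod_cast h3
      _ ≤ max κ (idealsLe K Y₀).ncard := le_max_right _ _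
      _ ≤ _ := le_mul_of_one_le_right (le_max_of_le_right (Nat.cast_nonneg _)) h1

lemma sum_idealsEq_le (N : ℕ) :
    ∑ n ∈ Finset.Icc 1 N, (idealsEq K n).ncard ≤ (idealsLe K N).ncard := by
  rw [← finsum_mem_coe_finset, ← Set.Finite.ncard_biUnion (Finset.finite_toSet _)
    (fun n _ => idealsEq_finite K n)]
  · refine Set.ncard_le_ncard ?_ (idealsLe_finite K N)
    simp only [Set.iUnion_subset_iff]
    intro n hn I hI
    have hI' : Ideal.absNorm (I : Ideal (𝓞 K)) = n := hI
    simp only [idealsLe, Set.mem_ofPred_eq, hI', Nat.cast_le]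
    simpa using (Finset.mem_Icc.1 (Finset.mem_coe.1 hn)).2
  · intro n _ n' _ hne
    exact Set.disjoint_left.2 fun I h h' => hne (h.symm.trans h')

lemma summable_idealsEq : Summable fun n : ℕ => ((idealsEq K n).ncard : ℝ) / (n : ℝ) ^ 2 := by
  obtain ⟨C, hC, hCY⟩ := exists_idealsLe_le K
  have h := LSeriesSummable_of_sum_norm_bigO_and_nonneg (r := 1) (s := 2)
    (f := fun n => ((idealsEq K n).ncard : ℝ)) ?_ (fun _ => Nat.cast_nonneg _) zero_le_one
    (by norm_num)
  · have h2 := h.norm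
    refine h2.congr fun n => ?_
    rcases eq_or_ne n 0 with rfl | hn
    · simp
    · rw [LSeries.term_of_ne_zero hn]
      simp
  · refine Asymptotics.IsBigO.of_bound C (Eventually.of_forall fun N => ?_)
    rw [Real.rpow_one, Real.norm_of_nonneg (Finset.sum_nonneg fun _ _ => Nat.cast_nonneg _),
      Real.norm_of_nonneg (Nat.cast_nonneg _)]
    refine le_trans ?_ (hCY N (Nat.cast_nonneg _))
    exact_mod_cast sum_idealsEq_le K N

/-- The pairs of ideals `(𝔟, 𝔧)` with `N 𝔟 > z` and `N (𝔟 ^ 2 𝔧) ≤ X`. -/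
def idealPairs (z : ℕ) (X : ℝ) : Set ((Ideal (𝓞 K))⁰ × (Ideal (𝓞 K))⁰) :=
  {x | z < Ideal.absNorm (x.1 : Ideal (𝓞 K)) ∧
    (Ideal.absNorm (x.1 : Ideal (𝓞 K)) : ℝ) ^ 2 * Ideal.absNorm (x.2 : Ideal (𝓞 K)) ≤ X}

lemma idealPairs_subset (z : ℕ) (X : ℝ) :
    idealPairs K z X ⊆ ⋃ n ∈ Finset.Ioc z ⌊X⌋₊, idealsEq K n ×ˢ idealsLe K (X / (n : ℝ) ^ 2) := by
  rintro ⟨b, j⟩ ⟨h1, h2⟩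
  have hb : (1 : ℝ) ≤ Ideal.absNorm (b : Ideal (𝓞 K)) := by exact_mod_cast one_le_absNorm K b
  have hj : (1 : ℝ) ≤ Ideal.absNorm (j : Ideal (𝓞 K)) := by exact_mod_cast one_le_absNorm K j
  simp only [Set.mem_iUnion]
  refine ⟨Ideal.absNorm (b : Ideal (𝓞 K)), Finset.mem_Ioc.2 ⟨h1, Nat.le_floor ?_⟩, rfl, ?_⟩
  · refine le_trans ?_ h2
    nlinarith
  · rw [idealsLe, Set.mem_ofPred_eq, le_div_iff₀ (by positivity), mul_comm]
    exact h2

lemma idealPairs_finite (z : ℕ) (X : ℝ) : (idealPairs K z X).Finite :=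
  (Set.Finite.biUnion (Finset.finite_toSet _) fun n _ =>
    (idealsEq_finite K n).prod (idealsLe_finite K _)).subset (idealPairs_subset K z X)

theorem exists_idealPairs_le : ∃ τ : ℕ → ℝ, Tendsto τ atTop (𝓝 0) ∧
    ∀ (z : ℕ) (X : ℝ), 0 ≤ X → ((idealPairs K z X).ncard : ℝ) ≤ τ z * X := by
  obtain ⟨C, hC, hCY⟩ := exists_idealsLe_le K
  set f : ℕ → ℝ := fun n : ℕ => ((idealsEq K n).ncard : ℝ) / (n : ℝ) ^ 2 with hf
  refine ⟨fun z => C * ∑' k, f (k + z), ?_, fun z X hX => ?_⟩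
  · simpa using (tendsto_sum_nat_add f).const_mul C
  have hsum := (summable_nat_add_iff z).2 (summable_idealsEq K)
  have hnn : ∀ n, 0 ≤ f n := fun n => by positivity
  have h1 : (idealPairs K z X).ncard ≤ ∑ n ∈ Finset.Ioc z ⌊X⌋₊,
      (idealsEq K n).ncard * (idealsLe K (X / (n : ℝ) ^ 2)).ncard := by
    refine (Set.ncard_le_ncard (idealPairs_subset K z X)
      (Set.Finite.biUnion (Finset.finite_toSet _) fun n _ =>
        (idealsEq_finite K n).prod (idealsLe_finite K _))).trans ?_
    refine (Finset.set_ncard_biUnion_le _ _).trans (Finset.sum_le_sum fun n _ => ?_)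
    rw [Set.ncard_prod]
  have h2 : (∑ n ∈ Finset.Ioc z ⌊X⌋₊,
      ((idealsEq K n).ncard * (idealsLe K (X / (n : ℝ) ^ 2)).ncard : ℝ)) ≤
      ∑ n ∈ Finset.Ioc z ⌊X⌋₊, C * X * f n := by
    refine Finset.sum_le_sum fun n _ => ?_
    calc ((idealsEq K n).ncard * (idealsLe K (X / (n : ℝ) ^ 2)).ncard : ℝ)
        ≤ (idealsEq K n).ncard * (C * (X / (n : ℝ) ^ 2)) := by
          gcongr
          exact hCY _ (by positivity)
      _ = C * X * f n := by rw [hf]; ring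
  have h3 : ∑ n ∈ Finset.Ioc z ⌊X⌋₊, f n ≤ ∑' k, f (k + z) := by
    have h4 : ∑ n ∈ Finset.Ioc z ⌊X⌋₊, f n ≤ ∑ n ∈ Finset.Ico z (⌊X⌋₊ + 1), f n :=
      Finset.sum_le_sum_of_subset_of_nonneg (fun n hn => by
        simp only [Finset.mem_Ioc, Finset.mem_Ico] at hn ⊢
        omega) fun n _ _ => hnn n
    refine h4.trans ?_
    rw [Finset.sum_Ico_eq_sum_range]
    simp_rw [add_comm z]
    exact hsum.sum_le_tsum _ fun n _ => hnn _
  calc ((idealPairs K z X).ncard : ℝ) ≤ ((∑ n ∈ Finset.Ioc z ⌊X⌋₊,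
        (idealsEq K n).ncard * (idealsLe K (X / (n : ℝ) ^ 2)).ncard : ℕ) : ℝ) := Nat.cast_le.2 h1
    _ ≤ ∑ n ∈ Finset.Ioc z ⌊X⌋₊, C * X * f n := by rw [Nat.cast_sum]; simpa using h2
    _ = C * X * ∑ n ∈ Finset.Ioc z ⌊X⌋₊, f n := by rw [Finset.mul_sum]
    _ ≤ C * X * ∑' k, f (k + z) := by gcongr
    _ = _ := by ring

end IdealPairs

section OrbitCount

open mixedEmbedding IsDedekindDomain Topology

variable {K : Type*} [Field K] [NumberField K]

/-- A unit of `𝓞 K` as a unit of `K`. -/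
def unitK : (𝓞 K)ˣ →* Kˣ := Units.map (algebraMap (𝓞 K) K : 𝓞 K →* K)

lemma unitK_injective : Function.Injective (unitK (K := K)) :=
  Units.map_injective (RingOfIntegers.coe_injective)

lemma prin_mul (x y : Kˣ) : prin (x * y) = prin x * prin y := map_mul _ x y

lemma prin_inv (x : Kˣ) : prin x⁻¹ = (prin x)⁻¹ := map_inv _ x

lemma prin_pow (x : Kˣ) (n : ℕ) : prin (x ^ n) = prin x ^ n := map_pow _ x n

lemma mem_prin_self (x : Kˣ) : (x : K) ∈ (prin x : FractionalIdeal (𝓞 K)⁰ K) :=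
  mem_of_prin_le le_rfl

lemma exists_unitK_of_prin_eq_one {s : Kˣ} (h : prin s = 1) : ∃ u, unitK u = s := by
  obtain ⟨y, hy⟩ := mem_one_fracUnits.1 (h ▸ mem_prin_self s)
  have h' : prin s⁻¹ = 1 := by rw [prin_inv, h, inv_one]
  obtain ⟨y', hy'⟩ := mem_one_fracUnits.1 (h' ▸ mem_prin_self s⁻¹)
  have hmul : y * y' = 1 := RingOfIntegers.coe_injective (by
    rw [map_mul, hy, hy', Units.mul_inv, map_one])
  exact ⟨Units.mkOfMulEqOne y y' hmul, Units.ext hy⟩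

lemma prin_unitK (u : (𝓞 K)ˣ) : prin (unitK u) = 1 := by
  refine le_antisymm ?_ ?_
  · rw [← Units.val_le_val, coe_toPrincipalIdeal, FractionalIdeal.spanSingleton_le_iff_mem]
    exact mem_one_fracUnits.2 ⟨u, rfl⟩
  · rw [← inv_le_one', ← map_inv, ← map_inv, ← Units.val_le_val, coe_toPrincipalIdeal,
      FractionalIdeal.spanSingleton_le_iff_mem]
    exact mem_one_fracUnits.2 ⟨((u⁻¹ : (𝓞 K)ˣ) : 𝓞 K), rfl⟩

lemma exists_prin_of_mk_eq_one {I : FracUnits K} (h : ClassGroup.mk K I = 1) :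
    ∃ s : Kˣ, prin s = I := by
  rw [ClassGroup.mk_eq_one_iff] at h
  obtain ⟨x, hx⟩ := h.principal
  have hx0 : x ≠ 0 := by
    rintro rfl
    refine I.ne_zero (FractionalIdeal.coeToSubmodule_injective ?_)
    change ((I : FractionalIdeal (𝓞 K)⁰ K) : Submodule (𝓞 K) K) = _
    rw [hx]
    simp
  refine ⟨Units.mk0 x hx0, Units.ext (FractionalIdeal.coeToSubmodule_injective ?_)⟩
  change _ = ((I : FractionalIdeal (𝓞 K)⁰ K) : Submodule (𝓞 K) K)
  rw [hx]
  simp only [coe_toPrincipalIdeal, FractionalIdeal.coe_spanSingleton, Units.val_mk0]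

lemma sqIdeal_mul_unitK_sq (α : Kˣ) (v : (𝓞 K)ˣ) : sqIdeal (α * unitK v ^ 2) = sqIdeal α := by
  rw [sqIdeal_mul_sq, ← map_inv, prin_unitK, one_mul]

lemma inCone_unitK_mul {β : Kˣ} (hβ : InCone β) (u : (𝓞 K)ˣ) :
    InCone (unitK u * β) ↔ u ∈ Units.torsion K := by
  rw [← fundamentalCone.unit_smul_mem_iff_mem_torsion hβ u, unitSMul_smul, ← map_mul]
  rfl

lemma exists_inCone (β : Kˣ) : ∃ u : (𝓞 K)ˣ, InCone (unitK u * β) := by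
  have h : mixedEmbedding.norm (mixedEmbedding K (β : K)) ≠ 0 := by
    rw [← fnorm_prin]
    exact (fnorm_pos _).ne'
  obtain ⟨u, hu⟩ := fundamentalCone.exists_unit_smul_mem h
  refine ⟨u, ?_⟩
  rw [unitSMul_smul, ← map_mul] at hu
  exact hu

variable (K) in
/-- The units of `𝓞 K` modulo squares. -/
abbrev UnitsModSq : Type _ := (𝓞 K)ˣ ⧸ (powMonoidHom 2 : (𝓞 K)ˣ →* (𝓞 K)ˣ).range

lemma mk_eq_mk_iff {u v : (𝓞 K)ˣ} :
    (QuotientGroup.mk u : UnitsModSq K) = QuotientGroup.mk v ↔ ∃ w : (𝓞 K)ˣ, v = u * w ^ 2 := by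
  rw [QuotientGroup.eq, MonoidHom.mem_range]
  refine exists_congr fun w => ?_
  rw [powMonoidHom_apply, eq_inv_mul_iff_mul_eq, eq_comm]

instance : Finite (UnitsModSq K) := by
  have : Group.FG (𝓞 K)ˣ := Group.fg_iff_monoid_fg.2 inferInstance
  refine CommGroup.finite_of_fg_isMulTorsion _ fun q => ?_
  induction q using QuotientGroup.induction_on with
  | H u =>
    refine isOfFinOrder_iff_pow_eq_one.2 ⟨2, two_pos, ?_⟩
    rw [← QuotientGroup.mk_pow, QuotientGroup.eq_one_iff]
    exact ⟨u, rfl⟩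

/-- The pairs `(q, β)` with `β` in the cone and `q β` generating a field of class `[𝔠]`. -/
def orbitSet (𝔠 : FracUnits K) (X : ℝ) : Set (UnitsModSq K × Kˣ) :=
  {x | InCone x.2 ∧ sqIdeal (unitK (Quotient.out x.1) * x.2) = 𝔠 ∧ fnorm (prin x.2 * 𝔠 ^ 2) ≤ X}

/-- The fields generated by square roots, with given class and bounded discriminant. The
trivial extension is allowed. -/
def fieldSet (𝒞 : ClassGroup (𝓞 K)) (X : ℝ) : Set (IntermediateField K (AlgebraicClosure K)) :=
  {L | ∃ α : Kˣ, sqrtField α = L ∧ ClassGroup.mk K (sqIdeal α) = 𝒞 ∧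
    fnorm (prin α * sqIdeal α ^ 2) ≤ X}

lemma prin_unitK_mul (u : (𝓞 K)ˣ) (β : Kˣ) : prin (unitK u * β) = prin β := by
  rw [prin_mul, prin_unitK, one_mul]

lemma orbitSet_mapsTo {𝔠 : FracUnits K} {𝒞 : ClassGroup (𝓞 K)} (hc : ClassGroup.mk K 𝔠 = 𝒞)
    (X : ℝ) : Set.MapsTo (fun x : UnitsModSq K × Kˣ => sqrtField (unitK (Quotient.out x.1) * x.2))
      (orbitSet 𝔠 X) (fieldSet 𝒞 X) := by
  rintro ⟨q, β⟩ ⟨-, h2, h3⟩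
  exact ⟨_, rfl, by rw [h2, hc], by rw [h2, prin_unitK_mul]; exact h3⟩

lemma prin_mul_sqIdeal_sq_mul_sq (α s : Kˣ) :
    prin (α * s ^ 2) * sqIdeal (α * s ^ 2) ^ 2 = prin α * sqIdeal α ^ 2 := by
  rw [sqIdeal_mul_sq, mul_pow, prin_mul, prin_pow, prin_inv]
  rw [inv_pow, mul_assoc, mul_inv_cancel_left]

lemma fieldSet_exists {𝔠 : FracUnits K} {𝒞 : ClassGroup (𝓞 K)} (hc : ClassGroup.mk K 𝔠 = 𝒞)
    {X : ℝ} {L : IntermediateField K (AlgebraicClosure K)} (hL : L ∈ fieldSet 𝒞 X) :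
    ∃ α : Kˣ, sqrtField α = L ∧ sqIdeal α = 𝔠 ∧ fnorm (prin α * 𝔠 ^ 2) ≤ X := by
  obtain ⟨α, rfl, h1, h2⟩ := hL
  obtain ⟨s, hs⟩ := exists_prin_of_mk_eq_one (I := sqIdeal α * 𝔠⁻¹)
    (by rw [map_mul, map_inv, h1, hc, mul_inv_cancel])
  have h3 : sqIdeal (α * s ^ 2) = 𝔠 := by
    rw [sqIdeal_mul_sq, prin_inv, hs]
    simp
  refine ⟨α * s ^ 2, sqrtField_mul_sq α s, h3, ?_⟩
  rw [← h3, prin_mul_sqIdeal_sq_mul_sq]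
  exact h2

lemma ncard_fiber {𝔠 : FracUnits K} {X : ℝ} {α : Kˣ} (h1 : sqIdeal α = 𝔠)
    (h2 : fnorm (prin α * 𝔠 ^ 2) ≤ X) :
    {x ∈ orbitSet 𝔠 X | sqrtField (unitK (Quotient.out x.1) * x.2) = sqrtField α}.ncard =
      Nat.card (Units.torsion K) := by
  obtain ⟨u, hu⟩ := exists_inCone α
  have himg : {x ∈ orbitSet 𝔠 X | sqrtField (unitK (Quotient.out x.1) * x.2) = sqrtField α} =
      Set.range (fun ζ : Units.torsion K =>
        ((QuotientGroup.mk ((ζ : (𝓞 K)ˣ) * u)⁻¹ : UnitsModSq K),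
          unitK (ζ : (𝓞 K)ˣ) * (unitK u * α))) := by
    ext ⟨q, β⟩
    constructor
    · rintro ⟨⟨hx1, hx2, hx3⟩, hx4⟩
      simp only at hx1 hx2 hx3 hx4
      obtain ⟨s, hs⟩ := sqrtField_eq_iff.1 hx4.symm
      have hs1 : prin s = 1 := by
        rw [hs, sqIdeal_mul_sq, h1, mul_eq_right, prin_inv, inv_eq_one] at hx2
        exact hx2
      obtain ⟨v, rfl⟩ := exists_unitK_of_prin_eq_one hs1
      have hβ : β = unitK ((Quotient.out q)⁻¹ * v ^ 2 * u⁻¹) * (unitK u * α) := by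
        rw [map_mul, map_mul, map_inv, map_inv, map_pow, mul_assoc, inv_mul_cancel_left, mul_assoc,
          mul_comm (_ ^ 2), ← hs, inv_mul_cancel_left]
      have hζ : (Quotient.out q)⁻¹ * v ^ 2 * u⁻¹ ∈ Units.torsion K := by
        rw [← inCone_unitK_mul hu, ← hβ]
        exact hx1
      refine ⟨⟨_, hζ⟩, Prod.ext ?_ hβ.symm⟩
      refine (mk_eq_mk_iff.2 ⟨v, ?_⟩).trans (QuotientGroup.out_eq' q)
      simp only [inv_mul_cancel_right, mul_inv, inv_inv]
    · rintro ⟨ζ, hζ⟩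
      rw [Prod.mk.injEq] at hζ
      obtain ⟨hq, rfl⟩ := hζ
      replace hq := mk_eq_mk_iff.1 (hq.trans (QuotientGroup.out_eq' q).symm)
      obtain ⟨w, hw⟩ := hq
      have hα : unitK (Quotient.out q) * (unitK (ζ : (𝓞 K)ˣ) * (unitK u * α)) =
          α * unitK w ^ 2 := by
        rw [hw, ← mul_assoc (unitK (ζ : (𝓞 K)ˣ)), ← map_mul, ← mul_assoc, ← map_mul, mul_right_comm,
          inv_mul_cancel, one_mul, map_pow, mul_comm]
      refine ⟨⟨(inCone_unitK_mul hu _).2 ζ.2, ?_, ?_⟩, ?_⟩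
      · simp only [hα]
        rw [sqIdeal_mul_unitK_sq, h1]
      · simp only [prin_unitK_mul]
        exact h2
      · simp only [hα, sqrtField_mul_sq]
  rw [himg, ← Set.image_univ, Set.ncard_image_of_injective, Set.ncard_univ]
  intro ζ ζ' h
  have h3 := (Prod.ext_iff.1 h).2
  exact Subtype.ext (unitK_injective (mul_right_cancel h3))

lemma orbitSet_finite (𝔠 : FracUnits K) (X : ℝ) : (orbitSet 𝔠 X).Finite := by
  refine Set.Finite.subset ((Set.finite_univ (α := UnitsModSq K)).prod
    (coneCoset_finite (𝔠 ^ 2)⁻¹ 0 (X / fnorm 𝔠 ^ 2))) ?_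
  rintro ⟨q, β⟩ ⟨h1, h2, h3⟩
  refine ⟨trivial, h1, ?_, ?_⟩
  · rw [sub_zero]
    exact (sqIdeal_eq_iff.1 h2).mem_of_unit
  · rwa [le_div_iff₀ (pow_pos (fnorm_pos _) 2), ← map_pow, ← map_mul]

lemma fieldSet_finite (𝒞 : ClassGroup (𝓞 K)) (X : ℝ) : (fieldSet 𝒞 X).Finite := by
  obtain ⟨I, hI⟩ := ClassGroup.mk0_surjective 𝒞
  have hc : ClassGroup.mk K (FractionalIdeal.mk0 K I) = 𝒞 := by rw [ClassGroup.mk_mk0, hI]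
  refine ((orbitSet_finite (FractionalIdeal.mk0 K I) X).image
    fun x => sqrtField (unitK (Quotient.out x.1) * x.2)).subset fun L hL => ?_
  obtain ⟨α, rfl, h1, h2⟩ := fieldSet_exists hc hL
  have h3 := ncard_fiber h1 h2
  have h4 : 0 < Nat.card (Units.torsion K) := Nat.card_pos
  rw [← h3] at h4
  obtain ⟨x, hx1, hx2⟩ := Set.nonempty_of_ncard_ne_zero h4.ne'
  exact ⟨x, hx1, hx2⟩

theorem ncard_orbitSet {𝔠 : FracUnits K} {𝒞 : ClassGroup (𝓞 K)} (hc : ClassGroup.mk K 𝔠 = 𝒞)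
    (X : ℝ) : (orbitSet 𝔠 X).ncard = (fieldSet 𝒞 X).ncard * Nat.card (Units.torsion K) := by
  classical
  rw [Set.ncard_eq_toFinset_card _ (orbitSet_finite 𝔠 X),
    Set.ncard_eq_toFinset_card _ (fieldSet_finite 𝒞 X),
    Finset.card_eq_sum_card_fiberwise
      (f := fun x : UnitsModSq K × Kˣ => sqrtField (unitK (Quotient.out x.1) * x.2))
      (t := (fieldSet_finite 𝒞 X).toFinset) (by simpa using orbitSet_mapsTo hc X),
    Finset.sum_const_nat]
  intro L hL
  obtain ⟨α, rfl, h1, h2⟩ := fieldSet_exists hc ((Set.Finite.mem_toFinset _).1 hL)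
  rw [← ncard_fiber h1 h2, ← Set.ncard_coe_finset]
  congr 1
  ext x
  simp

end OrbitCount

section Tail

open mixedEmbedding IsDedekindDomain Topology

variable {K : Type*} [Field K] [NumberField K]

lemma sievedCone_finite (P : Set (HeightOneSpectrum (𝓞 K))) (𝔠 : FracUnits K) (u : (𝓞 K)ˣ)
    (X : ℝ) : (sievedCone P 𝔠 u X).Finite := by
  refine (coneCoset_finite (𝔠 ^ 2)⁻¹ 0 (X / fnorm 𝔠 ^ 2)).subset ?_
  rintro β ⟨h1, h2, h3⟩
  refine ⟨h1, ?_, ?_⟩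
  · rw [sub_zero]
    exact h2.mem_of_unit
  · rwa [le_div_iff₀ (pow_pos (fnorm_pos _) 2), ← map_pow, ← map_mul]

lemma mem_orbitSet_iff {𝔠 : FracUnits K} {X : ℝ} {x : UnitsModSq K × Kˣ} :
    x ∈ orbitSet 𝔠 X ↔ x.2 ∈ sievedCone Set.univ 𝔠 (Quotient.out x.1) X :=
  and_congr_right fun _ => and_congr_left fun _ => sqIdeal_eq_iff

lemma ncard_orbitSet_eq_sum [Fintype (UnitsModSq K)] (𝔠 : FracUnits K) (X : ℝ) :
    (orbitSet 𝔠 X).ncard =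
      ∑ q : UnitsModSq K, (sievedCone Set.univ 𝔠 (Quotient.out q) X).ncard := by
  have h : orbitSet 𝔠 X = ⋃ q : UnitsModSq K,
      Prod.mk q '' sievedCone Set.univ 𝔠 (Quotient.out q) X := by
    ext ⟨q, β⟩
    rw [mem_orbitSet_iff]
    simp only [Set.mem_iUnion, Set.mem_image, Prod.mk.injEq]
    exact ⟨fun h => ⟨q, β, h, rfl, rfl⟩, by rintro ⟨_, _, h, rfl, rfl⟩; exact h⟩
  rw [h, Set.ncard_iUnion_of_finite (fun q => (sievedCone_finite _ _ _ _).image _),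
    finsum_eq_sum_of_fintype]
  · exact Finset.sum_congr rfl fun q _ =>
      Set.ncard_image_of_injective _ (Prod.mk_right_injective q)
  · intro q q' hne
    refine Set.disjoint_left.2 ?_
    rintro _ ⟨β, -, rfl⟩ ⟨β', -, h'⟩
    exact hne (Prod.ext_iff.1 h').1.symm

/-- A principal ideal has at most as many generators in the cone as there are roots of unity. -/
lemma inCone_prin_subset {I : FracUnits K} {β₀ : Kˣ} (h : InCone β₀) (hI : prin β₀ = I) :
    {β : Kˣ | InCone β ∧ prin β = I} ⊆
      Set.range fun ζ : Units.torsion K => unitK (ζ : (𝓞 K)ˣ) * β₀ := by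
  rintro β ⟨h1, h2⟩
  obtain ⟨u, hu⟩ := exists_unitK_of_prin_eq_one (s := β * β₀⁻¹)
    (by rw [prin_mul, prin_inv, h2, hI, mul_inv_cancel])
  have hβ : unitK u * β₀ = β := by rw [hu, inv_mul_cancel_right]
  exact ⟨⟨u, (inCone_unitK_mul h u).1 (hβ ▸ h1)⟩, hβ⟩

lemma ncard_inCone_prin_le {S : Set Kˣ} {I : FracUnits K}
    (hS : ∀ β ∈ S, InCone β ∧ prin β = I) : S.ncard ≤ Nat.card (Units.torsion K) := by
  rcases S.eq_empty_or_nonempty with rfl | ⟨β₀, hβ₀⟩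
  · simp
  · have hsub := (show S ⊆ _ from hS).trans (inCone_prin_subset (hS _ hβ₀).1 (hS _ hβ₀).2)
    refine (Set.ncard_le_ncard hsub (Set.finite_range _)).trans ?_
    rw [← Set.image_univ]
    exact (Set.ncard_image_le Set.finite_univ).trans (Set.ncard_univ _).le

variable (K) in
lemma finite_primesLe (z : ℕ) :
    {p : HeightOneSpectrum (𝓞 K) | Ideal.absNorm p.asIdeal ≤ z}.Finite := by
  refine Set.Finite.of_finite_image (f := fun p : HeightOneSpectrum (𝓞 K) =>
    (⟨p.asIdeal, mem_nonZeroDivisors_of_ne_zero p.ne_bot⟩ : (Ideal (𝓞 K))⁰))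
    ((idealsLe_finite K z).subset ?_) ?_
  · rintro _ ⟨p, hp, rfl⟩
    exact (Nat.cast_le (α := ℝ)).2 hp
  · intro p _ p' _ h
    exact HeightOneSpectrum.ext (congrArg Subtype.val h)

variable (K) in
/-- The primes of norm at most `z`. -/
def primesLe (z : ℕ) : Finset (HeightOneSpectrum (𝓞 K)) := (finite_primesLe K z).toFinset

lemma mem_primesLe {z : ℕ} {p : HeightOneSpectrum (𝓞 K)} :
    p ∈ primesLe K z ↔ Ideal.absNorm p.asIdeal ≤ z := by
  simp [primesLe]

lemma exists_idealPair {z : ℕ} {𝔠 : FracUnits K} {u : (𝓞 K)ˣ} {X : ℝ} {β : Kˣ}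
    (h : β ∈ sievedCone (primesLe K z) 𝔠 u X) (h' : β ∉ sievedCone Set.univ 𝔠 u X) :
    ∃ x ∈ idealPairs K z X,
      prin β * 𝔠 ^ 2 = FractionalIdeal.mk0 K x.1 ^ 2 * FractionalIdeal.mk0 K x.2 := by
  obtain ⟨h1, h2, h3⟩ := h
  obtain ⟨p, hp⟩ : ∃ p, SqLe ((primeUnit p)⁻¹ * 𝔠) ((unitK u * β : Kˣ) : K) := by
    by_contra! hcon
    exact h' ⟨h1, ⟨h2.1, fun p _ => hcon p⟩, h3⟩
  have hpz : z < Ideal.absNorm p.asIdeal := by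
    by_contra! hle
    exact h2.2 p (mem_primesLe.2 hle) hp
  have hle : prin β * ((primeUnit p)⁻¹ * 𝔠) ^ 2 ≤ 1 := by
    rw [← prin_unitK_mul u β]
    exact (mul_le_mul_right (pow_le_pow_left' (sqLe_iff.1 hp) 2) _).trans
      (prin_mul_sqIdeal_sq_le_one _)
  obtain ⟨j, hj⟩ := exists_eq_mk0 hle
  have heq : prin β * 𝔠 ^ 2 = primeUnit p ^ 2 * FractionalIdeal.mk0 K j := by
    rw [hj, mul_pow, inv_pow, mul_left_comm, mul_inv_cancel_left]
  refine ⟨(⟨p.asIdeal, mem_nonZeroDivisors_of_ne_zero p.ne_bot⟩, j), ⟨hpz, ?_⟩, heq⟩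
  rw [heq, map_mul, map_pow, primeUnit, fnorm_mk0, fnorm_mk0] at h3
  exact h3

lemma ncard_sievedCone_le (z : ℕ) (𝔠 : FracUnits K) (u : (𝓞 K)ˣ) (X : ℝ) :
    (sievedCone (primesLe K z) 𝔠 u X).ncard ≤ (sievedCone Set.univ 𝔠 u X).ncard +
      Nat.card (Units.torsion K) * (idealPairs K z X).ncard := by
  classical
  set T := sievedCone (primesLe K z) 𝔠 u X \ sievedCone Set.univ 𝔠 u X with hT
  have hTfin : T.Finite := (sievedCone_finite _ _ _ _).subset Set.sdiff_subset
  have hTcard : T.ncard ≤ Nat.card (Units.torsion K) * (idealPairs K z X).ncard := by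
    choose! f hf hf' using fun β (hβ : β ∈ T) => exists_idealPair hβ.1 hβ.2
    rw [Set.ncard_eq_toFinset_card _ hTfin, Set.ncard_eq_toFinset_card _ (idealPairs_finite K z X)]
    refine Finset.card_le_mul_card_image_of_maps_to (f := f) (fun β hβ => ?_) _ fun x _ => ?_
    · exact (Set.Finite.mem_toFinset _).2 (hf β ((Set.Finite.mem_toFinset _).1 hβ))
    · rw [← Set.ncard_coe_finset]
      refine ncard_inCone_prin_le
        (I := FractionalIdeal.mk0 K x.1 ^ 2 * FractionalIdeal.mk0 K x.2 * (𝔠 ^ 2)⁻¹) fun β hβ => ?_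
      obtain ⟨hβT, rfl⟩ := Finset.mem_filter.1 (Finset.mem_coe.1 hβ)
      rw [Set.Finite.mem_toFinset] at hβT
      exact ⟨hβT.1.1, by rw [← hf' β hβT, mul_inv_cancel_right]⟩
  have hsub : sievedCone (primesLe K z) 𝔠 u X ⊆ sievedCone Set.univ 𝔠 u X ∪ T := by
    rw [hT, Set.union_sdiff_self]
    exact Set.subset_union_right
  calc _ ≤ (sievedCone Set.univ 𝔠 u X ∪ T).ncard :=
        Set.ncard_le_ncard hsub ((sievedCone_finite _ _ _ _).union hTfin)
    _ ≤ _ := (Set.ncard_union_le _ _).trans (Nat.add_le_add_left hTcard _)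

lemma ncard_sievedCone_univ_le (P : Set (HeightOneSpectrum (𝓞 K))) (𝔠 : FracUnits K) (u : (𝓞 K)ˣ)
    (X : ℝ) : (sievedCone Set.univ 𝔠 u X).ncard ≤ (sievedCone P 𝔠 u X).ncard :=
  Set.ncard_le_ncard (fun _ h => ⟨h.1, ⟨h.2.1.1, fun p _ => h.2.1.2 p trivial⟩, h.2.2⟩)
    (sievedCone_finite _ _ _ _)

end Tail

section Equidistribution

open IsDedekindDomain Topology

variable {K : Type*} [Field K] [NumberField K]

/-- The number of elements surviving the sieve by the primes of norm at most `z`. -/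
def sievedCount [Fintype (UnitsModSq K)] (z : ℕ) (𝔠 : FracUnits K) (X : ℝ) : ℕ :=
  ∑ q : UnitsModSq K, (sievedCone (primesLe K z) 𝔠 (Quotient.out q) X).ncard

lemma ncard_orbitSet_le [Fintype (UnitsModSq K)] (z : ℕ) (𝔠 : FracUnits K) (X : ℝ) :
    (orbitSet 𝔠 X).ncard ≤ sievedCount z 𝔠 X := by
  rw [ncard_orbitSet_eq_sum]
  exact Finset.sum_le_sum fun q _ => ncard_sievedCone_univ_le _ _ _ _

lemma sievedCount_le [Fintype (UnitsModSq K)] (z : ℕ) (𝔠 : FracUnits K) (X : ℝ) :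
    sievedCount z 𝔠 X ≤ (orbitSet 𝔠 X).ncard + Fintype.card (UnitsModSq K) *
      (Nat.card (Units.torsion K) * (idealPairs K z X).ncard) := by
  rw [ncard_orbitSet_eq_sum, ← smul_eq_mul (Fintype.card _), ← Finset.card_univ,
    ← Finset.sum_const, ← Finset.sum_add_distrib]
  exact Finset.sum_le_sum fun q _ => ncard_sievedCone_le _ _ _ _

variable (K) in
lemma exists_tendsto_sievedCount [Fintype (UnitsModSq K)] (z : ℕ) :
    ∃ ℓ : ℝ, ∀ 𝒞 : ClassGroup (𝓞 K), ∃ 𝔠 : FracUnits K, ClassGroup.mk K 𝔠 = 𝒞 ∧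
      Tendsto (fun X : ℝ => (sievedCount z 𝔠 X : ℝ) / X) atTop (𝓝 ℓ) := by
  obtain ⟨m, hm⟩ := exists_eq_mk0 (sieveModulus_le_one (primesLe K z))
  refine ⟨∑ q : UnitsModSq K,
    (goodResidues (primesLe K z) (m : Ideal (𝓞 K)) (Quotient.out q)).ncard *
      (coneDensity K / fnorm (sieveModulus (primesLe K z))), fun 𝒞 => ?_⟩
  obtain ⟨𝔠, hc, h𝒞⟩ := exists_integralCoprime _ (sieveModulus_le_one (primesLe K z)) 𝒞
  refine ⟨𝔠, h𝒞, ?_⟩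
  simp only [sievedCount, Nat.cast_sum, Finset.sum_div]
  exact tendsto_finsetSum _ fun q _ => tendsto_sievedCone hc m hm _

theorem tendsto_fieldSet_sub (𝒞 𝒟 : ClassGroup (𝓞 K)) :
    Tendsto (fun X : ℝ => (((fieldSet 𝒞 X).ncard : ℝ) - (fieldSet 𝒟 X).ncard) / X) atTop (𝓝 0) := by
  have := Fintype.ofFinite (UnitsModSq K)
  obtain ⟨τ, hτ, hpairs⟩ := exists_idealPairs_le K
  set w : ℕ := Nat.card (Units.torsion K) with hw
  have hw1 : (1 : ℝ) ≤ w := by exact_mod_cast Nat.one_le_iff_ne_zero.2 Nat.card_pos.ne'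
  set n : ℕ := Fintype.card (UnitsModSq K) with hn
  refine Metric.tendsto_nhds.2 fun ε hε => ?_
  have hτ' : Tendsto (fun z => (n : ℝ) * (w * τ z)) atTop (𝓝 0) := by
    simpa using (hτ.const_mul (w : ℝ)).const_mul (n : ℝ)
  obtain ⟨z, hz⟩ := (hτ'.eventually (Iio_mem_nhds (half_pos hε))).exists
  obtain ⟨ℓ, hℓ⟩ := exists_tendsto_sievedCount K z
  obtain ⟨𝔠, hc, hlim⟩ := hℓ 𝒞
  obtain ⟨𝔡, hd, hlim'⟩ := hℓ 𝒟
  have hsub := hlim.sub hlim'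
  rw [sub_self] at hsub
  filter_upwards [Metric.tendsto_nhds.1 hsub _ (half_pos hε), eventually_gt_atTop 0] with X h1 h2
  rw [← sub_div] at h1
  rw [Real.dist_0_eq_abs, abs_div, abs_of_pos h2, div_lt_iff₀ h2] at h1 ⊢
  have bound : ∀ 𝔢 : FracUnits K, ((orbitSet 𝔢 X).ncard : ℝ) ≤ sievedCount z 𝔢 X ∧
      (sievedCount z 𝔢 X : ℝ) ≤ (orbitSet 𝔢 X).ncard + ε / 2 * X := by
    refine fun 𝔢 => ⟨by exact_mod_cast ncard_orbitSet_le z 𝔢 X, ?_⟩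
    have h3 : (sievedCount z 𝔢 X : ℝ) ≤ (orbitSet 𝔢 X).ncard + n * (w * (idealPairs K z X).ncard) := by
      exact_mod_cast sievedCount_le z 𝔢 X
    have h4 : (n : ℝ) * (w * (idealPairs K z X).ncard) ≤ n * (w * (τ z * X)) := by
      gcongr
      exact hpairs z X h2.le
    have h5 : (n : ℝ) * (w * (τ z * X)) ≤ ε / 2 * X := by
      rw [← mul_assoc (w : ℝ), ← mul_assoc]
      exact mul_le_mul_of_nonneg_right (le_of_lt hz) h2.le
    linarith
  have horb : ∀ {𝔢 : FracUnits K} {ℰ : ClassGroup (𝓞 K)}, ClassGroup.mk K 𝔢 = ℰ →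
      ((orbitSet 𝔢 X).ncard : ℝ) = (fieldSet ℰ X).ncard * w := fun h => by
    exact_mod_cast ncard_orbitSet h X
  have h6 : |((fieldSet 𝒞 X).ncard : ℝ) - (fieldSet 𝒟 X).ncard| * w < ε * X := by
    have h7 : ((orbitSet 𝔠 X).ncard : ℝ) - (orbitSet 𝔡 X).ncard =
        ((fieldSet 𝒞 X).ncard - (fieldSet 𝒟 X).ncard) * w := by
      rw [horb hc, horb hd, sub_mul]
    rw [← Nat.abs_cast w, ← abs_mul, ← h7]
    rw [abs_lt] at h1 ⊢
    have := bound 𝔠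
    have := bound 𝔡
    constructor <;> linarith
  exact (le_mul_of_one_le_right (abs_nonneg _) hw1).trans_lt h6

end Equidistribution

section LowerBound

open IsDedekindDomain Topology

variable {K : Type*} [Field K] [NumberField K]

variable (K) in
/-- The fields generated by square roots, with bounded discriminant. -/
def allFields (X : ℝ) : Set (IntermediateField K (AlgebraicClosure K)) :=
  {L | ∃ α : Kˣ, sqrtField α = L ∧ fnorm (prin α * sqIdeal α ^ 2) ≤ X}

lemma allFields_eq (X : ℝ) : allFields K X = ⋃ 𝒞, fieldSet 𝒞 X := by
  ext L
  simp only [allFields, fieldSet, Set.mem_iUnion, Set.mem_ofPred_eq]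
  exact ⟨fun ⟨α, h1, h2⟩ => ⟨_, α, h1, rfl, h2⟩, fun ⟨_, α, h1, _, h2⟩ => ⟨α, h1, h2⟩⟩

lemma allFields_finite (X : ℝ) : (allFields K X).Finite := by
  rw [allFields_eq]
  exact Set.finite_iUnion fun 𝒞 => fieldSet_finite 𝒞 X

lemma exists_two_prin_eq_four : ∃ t : Kˣ, (t : K) = 2 ∧ prin t ^ 2 = prin (four : Kˣ) := by
  refine ⟨Units.mk0 2 two_ne_zero, rfl, ?_⟩
  rw [← prin_pow]
  congr 1
  exact Units.ext (by norm_num [four])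

/-- Four times a principal integral ideal is a discriminant times a square. -/
lemma exists_disc_mul_sq {I : (Ideal (𝓞 K))⁰} (hI : ClassGroup.mk0 I = 1) :
    ∃ (β : Kˣ) (h D : (Ideal (𝓞 K))⁰),
      FractionalIdeal.mk0 K D = prin β * sqIdeal β ^ 2 ∧
      prin (four : Kˣ) * FractionalIdeal.mk0 K I =
        FractionalIdeal.mk0 K h ^ 2 * FractionalIdeal.mk0 K D := by
  obtain ⟨β, hβ⟩ := exists_prin_of_mk_eq_one (I := FractionalIdeal.mk0 K I)
    (by rw [ClassGroup.mk_mk0, hI])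
  obtain ⟨t, ht, ht4⟩ := exists_two_prin_eq_four (K := K)
  obtain ⟨y, hy⟩ : ∃ y : 𝓞 K, algebraMap _ K y = β :=
    mem_one_fracUnits.1 (mem_of_prin_le (hβ.trans_le (mk0_le_one I)))
  have hmem : prin t ≤ sqIdeal β := by
    rw [← Units.val_le_val, coe_toPrincipalIdeal, FractionalIdeal.spanSingleton_le_iff_mem,
      mem_sqIdeal]
    refine ⟨0, y, ?_⟩
    rw [ht, hy, map_zero]
    ring
  obtain ⟨h, hh⟩ := exists_eq_mk0 (mul_inv_le_one_iff_le.2 hmem)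
  obtain ⟨D, hD⟩ := exists_eq_mk0 (prin_mul_sqIdeal_sq_le_one β)
  refine ⟨β, h, D, hD, ?_⟩
  rw [hh, hD, ← hβ, ← ht4, mul_pow, inv_pow, mul_left_comm, mul_assoc, inv_mul_cancel, mul_one, mul_comm]

variable (K) in
/-- The principal integral ideals of norm at most `X`. -/
def principalLe (X : ℝ) : Set (Ideal (𝓞 K))⁰ :=
  {I | (Ideal.absNorm (I : Ideal (𝓞 K)) : ℝ) ≤ X ∧ ClassGroup.mk0 I = 1}

lemma ncard_principalLe_le (H : ℕ) (X : ℝ) :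
    (principalLe K X).ncard ≤ (idealsLe K H).ncard * (allFields K (fnorm (prin (four : Kˣ)) * X)).ncard +
      (idealPairs K H (fnorm (prin (four : Kˣ)) * X)).ncard := by
  have hfin : (principalLe K X).Finite := (idealsLe_finite K X).subset fun I hI => hI.1
  have hc := fnorm_pos (prin (four : Kˣ))
  choose! β h D hD hmul using fun I (hI : I ∈ principalLe K X) => exists_disc_mul_sq hI.2
  have hnorm : ∀ I ∈ principalLe K X, (Ideal.absNorm (h I : Ideal (𝓞 K)) : ℝ) ^ 2 *
      Ideal.absNorm (D I : Ideal (𝓞 K)) ≤ fnorm (prin (four : Kˣ)) * X := by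
    intro I hI
    rw [← fnorm_mk0, ← fnorm_mk0, ← map_pow, ← map_mul, ← hmul I hI, map_mul, fnorm_mk0]
    exact mul_le_mul_of_nonneg_left hI.1 hc.le
  have hinj : ∀ I ∈ principalLe K X, ∀ J ∈ principalLe K X, h I = h J → D I = D J → I = J := by
    intro I hI J hJ h1 h2
    have h3 := (hmul I hI).trans ((by rw [h1, h2]) : _ = _) |>.trans (hmul J hJ).symm
    exact Subtype.ext (le_antisymm (mk0_le_mk0.1 (mul_left_cancel h3).le)
      (mk0_le_mk0.1 (mul_left_cancel h3).ge))
  set S := {I ∈ principalLe K X | (Ideal.absNorm (h I : Ideal (𝓞 K)) : ℝ) ≤ H} with hS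
  set T := {I ∈ principalLe K X | H < Ideal.absNorm (h I : Ideal (𝓞 K))} with hT
  have hST : principalLe K X = S ∪ T := by
    ext I
    simp only [hS, hT, Set.mem_union, Set.mem_ofPred_eq, ← and_or_left, Nat.cast_le, le_or_gt,
      and_true]
  have hScard : S.ncard ≤
      (idealsLe K H ×ˢ allFields K (fnorm (prin (four : Kˣ)) * X)).ncard := by
    refine Set.ncard_le_ncard_of_injOn (fun I => (h I, sqrtField (β I))) ?_ ?_
      ((idealsLe_finite K H).prod (allFields_finite _))
    · rintro I ⟨hI, hIH⟩
      refine ⟨hIH, β I, rfl, ?_⟩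
      rw [← hD I hI, fnorm_mk0]
      refine le_trans ?_ (hnorm I hI)
      refine le_mul_of_one_le_left (Nat.cast_nonneg _) (one_le_pow₀ ?_)
      exact_mod_cast one_le_absNorm K (h I)
    · rintro I ⟨hI, -⟩ J ⟨hJ, -⟩ hIJ
      rw [Prod.mk.injEq] at hIJ
      refine hinj I hI J hJ hIJ.1 ?_
      obtain ⟨s, hs⟩ := sqrtField_eq_iff.1 hIJ.2
      have h4 : FractionalIdeal.mk0 K (D I) = FractionalIdeal.mk0 K (D J) := by
        rw [hD I hI, hD J hJ, hs, prin_mul_sqIdeal_sq_mul_sq]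
      exact Subtype.ext (le_antisymm (mk0_le_mk0.1 h4.le) (mk0_le_mk0.1 h4.ge))
  have hTcard : T.ncard ≤ (idealPairs K H (fnorm (prin (four : Kˣ)) * X)).ncard := by
    refine Set.ncard_le_ncard_of_injOn (fun I => (h I, D I)) ?_ ?_ (idealPairs_finite K _ _)
    · rintro I ⟨hI, hIH⟩
      exact ⟨hIH, hnorm I hI⟩
    · rintro I ⟨hI, -⟩ J ⟨hJ, -⟩ hIJ
      rw [Prod.mk.injEq] at hIJ
      exact hinj I hI J hJ hIJ.1 hIJ.2
  rw [Set.ncard_prod] at hScard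
  rw [hST]
  exact (Set.ncard_union_le _ _).trans (Nat.add_le_add hScard hTcard)

variable (K) in
lemma exists_tendsto_principalLe : ∃ κ : ℝ, 0 < κ ∧
    Tendsto (fun X : ℝ => ((principalLe K X).ncard : ℝ) / X) atTop (𝓝 κ) := by
  refine ⟨_, ?_, NumberField.Ideal.tendsto_norm_le_and_mk_eq_div_atTop K 1⟩
  refine div_pos (mul_pos (by positivity) (Units.regulator_pos K)) ?_
  exact mul_pos (Nat.cast_pos.2 (Units.torsionOrder_pos K))
    (Real.sqrt_pos_of_pos (abs_pos.2 (Int.cast_ne_zero.2 (discr_ne_zero K))))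

variable (K) in
theorem exists_le_ncard_allFields :
    ∃ c : ℝ, 0 < c ∧ ∀ᶠ X : ℝ in atTop, c * X ≤ (allFields K X).ncard := by
  obtain ⟨κ, hκ, hlim⟩ := exists_tendsto_principalLe K
  obtain ⟨τ, hτ, hpairs⟩ := exists_idealPairs_le K
  set a := fnorm (prin (four : Kˣ)) with ha
  have ha0 : 0 < a := fnorm_pos _
  have hτ' : Tendsto (fun z => τ z * a) atTop (𝓝 0) := by simpa using hτ.mul_const a
  obtain ⟨H, hH⟩ := (hτ'.eventually (Iio_mem_nhds (show 0 < κ / 4 by positivity))).exists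
  set M : ℝ := (idealsLe K H).ncard + 1 with hM
  have hM0 : 0 < M := by positivity
  refine ⟨κ / 4 / (M * a), by positivity, ?_⟩
  have hev : ∀ᶠ X : ℝ in atTop, κ / 4 / (M * a) * (a * X) ≤ (allFields K (a * X)).ncard := by
    filter_upwards [hlim.eventually (Ioi_mem_nhds (show κ / 2 < κ by linarith)),
      eventually_gt_atTop 0] with X h1 h2
    rw [lt_div_iff₀ h2] at h1
    have h3 : ((principalLe K X).ncard : ℝ) ≤ (idealsLe K H).ncard * (allFields K (a * X)).ncard +
        (idealPairs K H (a * X)).ncard := by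
      exact_mod_cast ncard_principalLe_le H X
    have h4 := hpairs H (a * X) (by positivity)
    have h5 : τ H * (a * X) ≤ κ / 4 * X := by
      rw [← mul_assoc]
      exact mul_le_mul_of_nonneg_right (le_of_lt hH) h2.le
    have h6 : κ / 4 / (M * a) * (a * X) = κ / 4 * X / M := by
      field_simp
    rw [h6, div_le_iff₀ hM0, hM]
    have h7 : (0 : ℝ) ≤ (allFields K (a * X)).ncard := Nat.cast_nonneg _
    linarith
  have hdiv : Tendsto (fun X : ℝ => X / a) atTop atTop := tendsto_id.atTop_div_const ha0
  filter_upwards [hdiv.eventually hev] with X hX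
  rwa [mul_div_cancel₀ _ ha0.ne'] at hX

end LowerBound

section Conclusion

open Topology

/-- Functions that pairwise agree up to `o(X)`, and whose sum is at least of order `X`, have equal
shares of the sum. -/
lemma tendsto_div_sum {ι : Type*} [Fintype ι] [Nonempty ι] {b : ι → ℝ → ℝ}
    (hb : ∀ i j, Tendsto (fun X => (b i X - b j X) / X) atTop (𝓝 0)) {c : ℝ} (hc : 0 < c)
    (hsum : ∀ᶠ X : ℝ in atTop, c * X ≤ ∑ j, b j X) (i : ι) :
    Tendsto (fun X => b i X / ∑ j, b j X) atTop (𝓝 (1 / (Fintype.card ι : ℝ))) := by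
  have hι : (Fintype.card ι : ℝ) ≠ 0 := Nat.cast_ne_zero.2 Fintype.card_ne_zero
  have h1 : Tendsto (fun X => |(∑ j, (b i X - b j X)) / X| / c) atTop (𝓝 0) := by
    simp only [Finset.sum_div]
    simpa using (tendsto_finsetSum Finset.univ fun j _ => hb i j).abs.div_const c
  have h2 : Tendsto (fun X => (∑ j, (b i X - b j X)) / ∑ j, b j X) atTop (𝓝 0) := by
    refine squeeze_zero_norm' ?_ h1
    filter_upwards [hsum, eventually_gt_atTop 0] with X hX hX0
    have hcX := mul_pos hc hX0
    rw [Real.norm_eq_abs, abs_div, abs_div, abs_of_pos (hcX.trans_le hX), abs_of_pos hX0, div_div,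
      mul_comm X]
    gcongr
  have h3 := (h2.const_add 1).div_const (Fintype.card ι : ℝ)
  rw [add_zero] at h3
  refine h3.congr' ?_
  filter_upwards [hsum, eventually_gt_atTop 0] with X hX hX0
  have hB : ∑ j, b j X ≠ 0 := ((mul_pos hc hX0).trans_le hX).ne'
  rw [Finset.sum_sub_distrib, Finset.sum_const, Finset.card_univ, nsmul_eq_mul]
  field_simp
  ring

variable {K : Type*} [Field K] [NumberField K]

lemma absNorm_relDisc_sqrtField {α : Kˣ} (hα : ¬ IsSquare (α : K)) :
    (Ideal.absNorm (relDisc K (sqrtField α)) : ℝ) = fnorm (prin α * sqIdeal α ^ 2) := by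
  rw [fnorm_apply, ← coe_relDisc (sqrtGen_sq α) hα (finrank_sqrtField hα),
    FractionalIdeal.coeIdeal_absNorm]
  simp

lemma allFields_diff_bot (X : ℝ) : allFields K X \ {⊥} =
    {L : IntermediateField K (AlgebraicClosure K) | Module.finrank K L = 2 ∧
      (Ideal.absNorm (relDisc K L) : ℝ) ≤ X} := by
  ext L
  constructor
  · rintro ⟨⟨α, rfl, h2⟩, hbot⟩
    have hα : ¬ IsSquare (α : K) := fun h => hbot (sqrtField_eq_bot_iff.2 h)
    exact ⟨finrank_sqrtField hα, by rwa [absNorm_relDisc_sqrtField hα]⟩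
  · rintro ⟨h1, h2⟩
    obtain ⟨α, hα, rfl⟩ := exists_sqrtField_eq h1
    refine ⟨⟨α, rfl, by rwa [absNorm_relDisc_sqrtField hα] at h2⟩, fun h => ?_⟩
    exact hα (sqrtField_eq_bot_iff.1 h)

lemma fieldSet_diff_bot (𝒞 : ClassGroup (𝓞 K)) (X : ℝ) : fieldSet 𝒞 X \ {⊥} =
    {L : IntermediateField K (AlgebraicClosure K) | Module.finrank K L = 2 ∧
      (Ideal.absNorm (relDisc K L) : ℝ) ≤ X ∧ IsSteinitzClass K L 𝒞} := by
  ext L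
  constructor
  · rintro ⟨⟨α, rfl, h1, h2⟩, hbot⟩
    have hα : ¬ IsSquare (α : K) := fun h => hbot (sqrtField_eq_bot_iff.2 h)
    exact ⟨finrank_sqrtField hα, by rwa [absNorm_relDisc_sqrtField hα],
      (isSteinitzClass_iff (sqrtGen_sq α) hα (finrank_sqrtField hα) 𝒞).2 h1⟩
  · rintro ⟨h1, h2, h3⟩
    obtain ⟨α, hα, rfl⟩ := exists_sqrtField_eq h1
    refine ⟨⟨α, rfl, (isSteinitzClass_iff (sqrtGen_sq α) hα h1 𝒞).1 h3,
      by rwa [absNorm_relDisc_sqrtField hα] at h2⟩, fun h => ?_⟩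
    exact hα (sqrtField_eq_bot_iff.1 h)

lemma fieldSet_disjoint {𝒞 𝒟 : ClassGroup (𝓞 K)} (h : 𝒞 ≠ 𝒟) (X : ℝ) :
    Disjoint (fieldSet 𝒞 X) (fieldSet 𝒟 X) := by
  refine Set.disjoint_left.2 ?_
  rintro _ ⟨α, rfl, rfl, -⟩ ⟨β, hβ, rfl, -⟩
  obtain ⟨s, rfl⟩ := sqrtField_eq_iff.1 hβ.symm
  exact h (by rw [sqIdeal_mul_sq, map_mul, mk_prin, one_mul])

/-- The number of quadratic extensions of given class and bounded discriminant. -/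
def quadCount (𝒞 : ClassGroup (𝓞 K)) (X : ℝ) : ℝ := (fieldSet 𝒞 X \ {⊥}).ncard

lemma sum_quadCount (X : ℝ) :
    ∑ 𝒞, quadCount (K := K) 𝒞 X = ((allFields K X \ {⊥}).ncard : ℝ) := by
  rw [allFields_eq, Set.iUnion_sdiff, Set.ncard_iUnion_of_finite
    (fun 𝒞 => (fieldSet_finite 𝒞 X).subset Set.sdiff_subset), finsum_eq_sum_of_fintype, Nat.cast_sum]
  · rfl
  · exact fun 𝒞 𝒟 h => (fieldSet_disjoint h X).mono Set.sdiff_subset Set.sdiff_subset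

lemma quadCount_bounds (𝒞 : ClassGroup (𝓞 K)) (X : ℝ) :
    quadCount 𝒞 X ≤ (fieldSet 𝒞 X).ncard ∧ ((fieldSet 𝒞 X).ncard : ℝ) ≤ quadCount 𝒞 X + 1 := by
  refine ⟨Nat.cast_le.2 (Set.ncard_le_ncard Set.sdiff_subset (fieldSet_finite 𝒞 X)), ?_⟩
  have h := Set.ncard_le_ncard_sdiff_add_ncard (fieldSet 𝒞 X) {⊥}
  rw [Set.ncard_singleton] at h
  rw [quadCount]
  exact_mod_cast h

lemma tendsto_quadCount_sub (𝒞 𝒟 : ClassGroup (𝓞 K)) :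
    Tendsto (fun X : ℝ => (quadCount 𝒞 X - quadCount 𝒟 X) / X) atTop (𝓝 0) := by
  have h1 := tendsto_fieldSet_sub 𝒞 𝒟
  have h2 : Tendsto (fun X : ℝ => 1 / X) atTop (𝓝 0) := tendsto_const_nhds.div_atTop tendsto_id
  have h3 := h1.sub h2
  have h4 := h1.add h2
  rw [sub_zero] at h3
  rw [add_zero] at h4
  refine tendsto_of_tendsto_of_tendsto_of_le_of_le' h3 h4 ?_ ?_ <;>
  · filter_upwards [eventually_gt_atTop 0] with X hX
    have := quadCount_bounds 𝒞 X
    have := quadCount_bounds 𝒟 X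
    simp only [← sub_div, ← add_div]
    refine div_le_div_of_nonneg_right ?_ hX.le
    linarith

variable (K) in
lemma exists_le_sum_quadCount :
    ∃ c : ℝ, 0 < c ∧ ∀ᶠ X : ℝ in atTop, c * X ≤ ∑ 𝒞, quadCount (K := K) 𝒞 X := by
  obtain ⟨c, hc, hev⟩ := exists_le_ncard_allFields K
  refine ⟨c / 2, half_pos hc, ?_⟩
  filter_upwards [hev, eventually_ge_atTop (2 / c)] with X h1 h2
  rw [div_le_iff₀ hc] at h2
  have h3 : ((allFields K X).ncard : ℝ) ≤ (allFields K X \ {⊥}).ncard + 1 := by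
    have h := Set.ncard_le_ncard_sdiff_add_ncard (allFields K X) {⊥}
    rw [Set.ncard_singleton] at h
    exact_mod_cast h
  rw [sum_quadCount]
  linarith

end Conclusion

end SteinitzQuadratic

/-- **Equidistribution of Steinitz classes of quadratic extensions (Kable–Wright).**
Let `K` be a number field with class number `h_K` and `𝒞` an ideal class of `K`.  The
proportion of quadratic extensions `L/K` (up to `K`-isomorphism inside a fixed algebraic
closure, ordered by the norm of the relative discriminant) with Steinitz class `𝒞`
tends to `1/h_K`. -/
theorem steinitz_equidistribution_quadratic
    (K : Type*) [Field K] [NumberField K] (𝒞 : ClassGroup (𝓞 K)) :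
    Tendsto (fun X : ℝ =>
      (Nat.card {L : IntermediateField K (AlgebraicClosure K) //
          Module.finrank K L = 2 ∧ (Ideal.absNorm (relDisc K L) : ℝ) ≤ X ∧
          IsSteinitzClass K L 𝒞} : ℝ) /
      (Nat.card {L : IntermediateField K (AlgebraicClosure K) //
          Module.finrank K L = 2 ∧ (Ideal.absNorm (relDisc K L) : ℝ) ≤ X} : ℝ))
      atTop (nhds (1 / (classNumber K : ℝ))) := by
  obtain ⟨c, hc, hsum⟩ := SteinitzQuadratic.exists_le_sum_quadCount K
  refine (SteinitzQuadratic.tendsto_div_sum SteinitzQuadratic.tendsto_quadCount_sub hc hsum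
    𝒞).congr fun X => ?_
  rw [SteinitzQuadratic.sum_quadCount, SteinitzQuadratic.quadCount,
    SteinitzQuadratic.fieldSet_diff_bot, SteinitzQuadratic.allFields_diff_bot]
  rfl

end
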